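/- Let S be a λ_CLC-structure with underlying weakly closed Freyd operad (V, C, I). For any contexts Γ₁,…,Γₙ and values V₁,…,Vₙ with Γᵢ ⊢ᵥ Vᵢ: every value x₁,…,xₙ ⊢ᵥ W satisfies ⟦W[x₁ := V₁,…,xₙ := Vₙ]⟧ = ⟦W⟧{⟦V₁⟧ + … + ⟦Vₙ⟧}, and every computation x₁,…,xₙ ⊢꜀ M satisfies ⟦M[x₁ := V₁,…,xₙ := Vₙ]⟧ = ⟦M⟧{I⟦V₁⟧ + … + I⟦Vₙ⟧}, where the braces denote the order-independent parallel substitution of the given central elements into the n inputs. -/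

import Mathlib

universe u

/-- A renaming from `m` to `n` is a function `Fin m → Fin n`. -/
abbrev Ren (m n : ℕ) : Type := Fin m → Fin n

/-- The identity renaming. -/
def idRen (n : ℕ) : Ren n n := fun i => i

/-- Block sum of renamings. -/
def bsum {m₁ n₁ m₂ n₂ : ℕ} (r : Ren m₁ n₁) (r' : Ren m₂ n₂) : Ren (m₁ + m₂) (n₁ + n₂) :=
  fun i => Fin.addCases (motive := fun _ => Fin (n₁ + n₂))
    (fun a => Fin.castAdd n₂ (r a)) (fun b => Fin.natAdd n₁ (r' b)) i

/-- The block swap `σ_{m,n} : m+n → n+m`. -/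
def swapRen (m n : ℕ) : Ren (m + n) (n + m) :=
  fun i => Fin.addCases (motive := fun _ => Fin (n + m))
    (fun a => Fin.natAdd n a) (fun b => Fin.castAdd m b) i

/-- The copy renaming `Δ_n : n+n → n`, sending both copies of `i` to `i`. -/
def copyRen (n : ℕ) : Ren (n + n) n :=
  fun i => Fin.addCases (motive := fun _ => Fin n) (fun a => a) (fun b => b) i

/-- The discard renaming `!_n : 0 → n` (the empty function). -/
def discardRen (n : ℕ) : Ren 0 n := fun i => i.elim0

/-- Cast along an equality of arities. -/
def acast {C : ℕ → Type u} {m n : ℕ} (h : m = n) : C m → C n := fun x => h ▸ x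

/-- Cast along equalities of both arities. -/
def hcast {H : ℕ → ℕ → Type u} {a a' b b' : ℕ} (h₁ : a = a') (h₂ : b = b') : H a b → H a' b' :=
  fun f => h₂ ▸ h₁ ▸ f

/-- A preoperad: a family of sets `C n` with an identity `one ∈ C 1` and single
substitution `f{n₁ ⊣ g ⊢ n₂}`, satisfying unit and associativity laws. -/
structure Preoperad where
  C : ℕ → Type
  one : C 1
  subst : ∀ (n₁ n₂ : ℕ) {m : ℕ}, C (n₁ + 1 + n₂) → C m → C (n₁ + m + n₂)
  left_unit : ∀ {m : ℕ} (g : C m), subst 0 0 one g = acast (C := C) (by omega) g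
  right_unit : ∀ {n₁ n₂ : ℕ} (f : C (n₁ + 1 + n₂)), subst n₁ n₂ f one = f
  assoc : ∀ {m₁ m₂ n₁ n₂ k : ℕ} (f : C (m₁ + 1 + m₂)) (g : C (n₁ + 1 + n₂)) (h : C k),
    subst (m₁ + n₁) (n₂ + m₂) (acast (C := C) (by omega) (subst m₁ m₂ f g)) h =
      acast (C := C) (by omega) (subst m₁ m₂ f (subst n₁ n₂ g h))

/-- Two elements `g₁ ∈ C k₁`, `g₂ ∈ C k₂` of a preoperad commute when substituting them
into the two distinguished inputs of any morphism in either order yields the same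
result (in both orientations). -/
def Preoperad.Commute (P : Preoperad) {k₁ k₂ : ℕ} (g₁ : P.C k₁) (g₂ : P.C k₂) : Prop :=
  ∀ (m₁ m m₂ : ℕ) (f : P.C (m₁ + 1 + m + 1 + m₂)),
    (P.subst (m₁ + k₁ + m) m₂
        (acast (C := P.C) (by omega)
          (P.subst m₁ (m + 1 + m₂) (acast (C := P.C) (by omega) f) g₁)) g₂ =
      acast (C := P.C) (by omega)
        (P.subst m₁ (m + k₂ + m₂)
          (acast (C := P.C) (by omega) (P.subst (m₁ + 1 + m) m₂ f g₂)) g₁)) ∧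
    (P.subst (m₁ + k₂ + m) m₂
        (acast (C := P.C) (by omega)
          (P.subst m₁ (m + 1 + m₂) (acast (C := P.C) (by omega) f) g₂)) g₁ =
      acast (C := P.C) (by omega)
        (P.subst m₁ (m + k₁ + m₂)
          (acast (C := P.C) (by omega) (P.subst (m₁ + 1 + m) m₂ f g₁)) g₂))

/-- An element is central if it commutes with every element. -/
def Preoperad.Central (P : Preoperad) {k : ℕ} (g : P.C k) : Prop :=
  ∀ {k' : ℕ} (g' : P.C k'), P.Commute g g'

/-- A `Ren`-cartesian preoperad: a preoperad equipped with reindexing `f[r]` along all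
renamings, functorially, and satisfying the renaming–substitution interchange law. -/
structure RenPreoperad extends Preoperad where
  ren : ∀ {m n : ℕ}, C m → Ren m n → C n
  ren_id : ∀ {m : ℕ} (f : C m), ren f (idRen m) = f
  ren_comp : ∀ {m n k : ℕ} (f : C m) (r₁ : Ren m n) (r₂ : Ren n k),
    ren f (r₂ ∘ r₁) = ren (ren f r₁) r₂
  ren_subst : ∀ {n₁ n₂ k m₁ m₂ m : ℕ} (f : C (n₁ + 1 + n₂)) (g : C k)
      (r₁ : Ren n₁ m₁) (r : Ren k m) (r₂ : Ren n₂ m₂),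
    ren (subst n₁ n₂ f g) (bsum (bsum r₁ r) r₂) =
      subst m₁ m₂ (ren f (bsum (bsum r₁ (idRen 1)) r₂)) (ren g r)

/-- A symmetric `Ren`-cartesian preoperad: transpositions are natural with respect to
single substitution, in both orientations. -/
structure SymRenPreoperad extends RenPreoperad where
  sym_nat₁ : ∀ {m₁ m₂ n : ℕ} (f : C (m₁ + 2 + m₂)) (g : C n),
    subst m₁ (1 + m₂)
        (acast (C := C) (by omega)
          (ren f (bsum (bsum (idRen m₁) (swapRen 1 1)) (idRen m₂)))) g =
      acast (C := C) (by omega)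
        (ren (acast (C := C) (by omega) (subst (m₁ + 1) m₂ f g))
          (bsum (bsum (idRen m₁) (swapRen 1 n)) (idRen m₂)))
  sym_nat₂ : ∀ {m₁ m₂ n : ℕ} (f : C (m₁ + 2 + m₂)) (g : C n),
    subst (m₁ + 1) m₂
        (ren f ((bsum (bsum (idRen m₁) (swapRen 1 1)) (idRen m₂) :
          Ren (m₁ + (1 + 1) + m₂) (m₁ + (1 + 1) + m₂)))) g =
      acast (C := C) (by omega)
        (ren (acast (C := C) (by omega) (subst m₁ (1 + m₂) (acast (C := C) (by omega) f) g))
          (bsum (bsum (idRen m₁) (swapRen n 1)) (idRen m₂)))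

/-- A cartesian operad: a `Ren`-cartesian symmetric preoperad in which every element is
central and in which discard and copy are natural with respect to single substitution. -/
structure CartOperad extends SymRenPreoperad where
  central : ∀ {k : ℕ} (g : C k), toPreoperad.Central g
  discard_nat : ∀ {m₁ m₂ n : ℕ} (f : C (m₁ + 0 + m₂)) (g : C n),
    subst m₁ m₂
        (ren f ((bsum (bsum (idRen m₁) (discardRen 1)) (idRen m₂) :
          Ren (m₁ + 0 + m₂) (m₁ + 1 + m₂)))) g =
      ren f ((bsum (bsum (idRen m₁) (discardRen n)) (idRen m₂) :
        Ren (m₁ + 0 + m₂) (m₁ + n + m₂)))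
  copy_nat : ∀ {m₁ m₂ n : ℕ} (f : C (m₁ + 2 + m₂)) (g : C n),
    subst m₁ m₂
        (ren f ((bsum (bsum (idRen m₁) (copyRen 1)) (idRen m₂) :
          Ren (m₁ + (1 + 1) + m₂) (m₁ + 1 + m₂)))) g =
      ren (acast (C := C) (by omega)
            (subst m₁ (n + m₂) (acast (C := C) (by omega) (subst (m₁ + 1) m₂ f g)) g))
        ((bsum (bsum (idRen m₁) (copyRen n)) (idRen m₂) :
          Ren (m₁ + (n + n) + m₂) (m₁ + n + m₂)))

/-- A cartesian preoperad functor: preserves the identity, single substitution and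
reindexing. -/
structure RenPreoperadHom (P Q : RenPreoperad) where
  map : ∀ {n : ℕ}, P.C n → Q.C n
  map_one : map P.one = Q.one
  map_subst : ∀ {n₁ n₂ m : ℕ} (f : P.C (n₁ + 1 + n₂)) (g : P.C m),
    map (P.subst n₁ n₂ f g) = Q.subst n₁ n₂ (map f) (map g)
  map_ren : ∀ {m n : ℕ} (f : P.C m) (r : Ren m n), map (P.ren f r) = Q.ren (map f) r

/-- Composition of cartesian preoperad functors. -/
def RenPreoperadHom.comp {P Q R : RenPreoperad} (F : RenPreoperadHom P Q)
    (G : RenPreoperadHom Q R) : RenPreoperadHom P R where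
  map f := G.map (F.map f)
  map_one := by show G.map (F.map P.one) = _; rw [F.map_one, G.map_one]
  map_subst f g := by
    show G.map (F.map _) = _
    rw [F.map_subst, G.map_subst]
  map_ren f r := by
    show G.map (F.map _) = _
    rw [F.map_ren, G.map_ren]

/-- A Freyd operad: a cartesian operad `V` of values, a symmetric `Ren`-cartesian
preoperad `C` of computations, and a cartesian preoperad functor `I : V → C` whose image
consists of central elements (and hence forms a cartesian operad). -/
structure FreydOperad where
  V : CartOperad
  C : SymRenPreoperad
  I : RenPreoperadHom V.toRenPreoperad C.toRenPreoperad
  I_central : ∀ {n : ℕ} (v : V.C n), C.toPreoperad.Central (I.map v)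

/-- A Freyd operad functor: a pair of cartesian preoperad functors commuting with the
functors `I`. -/
structure FreydOperadHom (O₁ O₂ : FreydOperad) where
  mapV : RenPreoperadHom O₁.V.toRenPreoperad O₂.V.toRenPreoperad
  mapC : RenPreoperadHom O₁.C.toRenPreoperad O₂.C.toRenPreoperad
  square : ∀ {n : ℕ} (v : O₁.V.C n), mapC.map (O₁.I.map v) = O₂.I.map (mapV.map v)

/-- Composition of Freyd operad functors. -/
def FreydOperadHom.comp {O₁ O₂ O₃ : FreydOperad} (F : FreydOperadHom O₁ O₂)
    (G : FreydOperadHom O₂ O₃) : FreydOperadHom O₁ O₃ where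
  mapV := F.mapV.comp G.mapV
  mapC := F.mapC.comp G.mapC
  square v := by
    show G.mapC.map (F.mapC.map _) = _
    rw [F.square, G.square]; rfl

/-- A weakly closed Freyd operad: abstraction `λₙ : C(n+1) → V(n)` and application
`@ ∈ C 2` satisfying the β-law and compatibility of abstraction with substitution. -/
structure WCFreydOperad extends FreydOperad where
  abs : ∀ {n : ℕ}, C.C (n + 1) → V.C n
  app : C.C 2
  beta : ∀ {n : ℕ} (f : C.C (n + 1)),
    C.subst 0 1 app (I.map (abs f)) = acast (C := C.C) (by omega) f
  abs_subst : ∀ {m₁ m₂ k : ℕ} (f : C.C (m₁ + 1 + (m₂ + 1))) (v : V.C k),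
    abs (acast (C := C.C) (by omega) (C.subst m₁ (m₂ + 1) f (I.map v))) =
      V.subst m₁ m₂ (abs (acast (C := C.C) (by omega) f)) v

/-- A signature: function symbols and procedure symbols, each with an arity. -/
structure Sig where
  Func : Type
  fArity : Func → ℕ
  Proc : Type
  pArity : Proc → ℕ

mutual
/-- Values of λ_CLC, well formed in a context `x₁, …, xₙ` (de Bruijn presentation):
variables, function-symbol applications, and λ-abstractions. -/
inductive DVal (Sg : Sig) : ℕ → Type
  | var {n : ℕ} (i : Fin n) : DVal Sg n
  | func {n : ℕ} (f : Sg.Func) (args : Fin (Sg.fArity f) → DVal Sg n) : DVal Sg n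
  | lam {n : ℕ} (M : DCmp Sg (n + 1)) : DVal Sg n

/-- Computations of λ_CLC, well formed in a context `x₁, …, xₙ`: returned values,
sequencing `let x = M₁ in M₂`, procedure-symbol applications, and applications. -/
inductive DCmp (Sg : Sig) : ℕ → Type
  | ret {n : ℕ} (W : DVal Sg n) : DCmp Sg n
  | letin {n : ℕ} (M₁ : DCmp Sg n) (M₂ : DCmp Sg (n + 1)) : DCmp Sg n
  | proc {n : ℕ} (p : Sg.Proc) (args : Fin (Sg.pArity p) → DVal Sg n) : DCmp Sg n
  | app {n : ℕ} (V₁ V₂ : DVal Sg n) : DCmp Sg n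
end

/-- Lift a renaming under a binder. -/
def liftRen {m n : ℕ} (r : Fin m → Fin n) : Fin (m + 1) → Fin (n + 1) :=
  fun i => Fin.lastCases (Fin.last n) (fun j => (r j).castSucc) i

mutual
/-- Rename the free variables of a value. -/
def renameV {Sg : Sig} : ∀ {m n : ℕ}, DVal Sg m → (Fin m → Fin n) → DVal Sg n
  | _, _, .var i, r => .var (r i)
  | _, _, .func f args, r => .func f (fun i => renameV (args i) r)
  | _, _, .lam M, r => .lam (renameC M (liftRen r))

/-- Rename the free variables of a computation. -/
def renameC {Sg : Sig} : ∀ {m n : ℕ}, DCmp Sg m → (Fin m → Fin n) → DCmp Sg n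
  | _, _, .ret W, r => .ret (renameV W r)
  | _, _, .letin M₁ M₂, r => .letin (renameC M₁ r) (renameC M₂ (liftRen r))
  | _, _, .proc p args, r => .proc p (fun i => renameV (args i) r)
  | _, _, .app V₁ V₂, r => .app (renameV V₁ r) (renameV V₂ r)
end

/-- Lift a simultaneous substitution under a binder. -/
def liftSub {Sg : Sig} {m n : ℕ} (σ : Fin m → DVal Sg n) : Fin (m + 1) → DVal Sg (n + 1) :=
  fun i => Fin.lastCases (.var (Fin.last n)) (fun j => renameV (σ j) Fin.castSucc) i

mutual
/-- Capture-avoiding simultaneous substitution of values for the free variables of a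
value. -/
def substV {Sg : Sig} : ∀ {m n : ℕ}, DVal Sg m → (Fin m → DVal Sg n) → DVal Sg n
  | _, _, .var i, σ => σ i
  | _, _, .func f args, σ => .func f (fun i => substV (args i) σ)
  | _, _, .lam M, σ => .lam (substC M (liftSub σ))

/-- Capture-avoiding simultaneous substitution of values for the free variables of a
computation. -/
def substC {Sg : Sig} : ∀ {m n : ℕ}, DCmp Sg m → (Fin m → DVal Sg n) → DCmp Sg n
  | _, _, .ret W, σ => .ret (substV W σ)
  | _, _, .letin M₁ M₂, σ => .letin (substC M₁ σ) (substC M₂ (liftSub σ))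
  | _, _, .proc p args, σ => .proc p (fun i => substV (args i) σ)
  | _, _, .app V₁ V₂, σ => .app (substV V₁ σ) (substV V₂ σ)
end

/-- Length of the concatenation of a family of contexts with sizes `k 0, …, k (n-1)`. -/
def finSum : ∀ {n : ℕ}, (Fin n → ℕ) → ℕ
  | 0, _ => 0
  | n + 1, k => finSum (fun i => k i.castSucc) + k (Fin.last n)

/-- The embedding of the `i`-th block into the concatenation of blocks of sizes `k`. -/
def blockInj : ∀ {n : ℕ} (k : Fin n → ℕ) (i : Fin n), Fin (k i) → Fin (finSum k)
  | n + 1, k, i =>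
      Fin.lastCases (motive := fun i => Fin (k i) → Fin (finSum k))
        (fun a => Fin.natAdd (finSum fun j => k j.castSucc) a)
        (fun j a => Fin.castAdd (k (Fin.last n)) (blockInj (fun j => k j.castSucc) j a))
        i

/-- Case analysis on the concatenation of blocks of sizes `k`. -/
def finSumCases : ∀ {n : ℕ} (k : Fin n → ℕ) {α : Sort _},
    (∀ i, Fin (k i) → α) → Fin (finSum k) → α
  | 0, _, _, _, j => j.elim0
  | n + 1, k, _, h, j =>
      Fin.addCases (fun a => finSumCases (fun i => k i.castSucc) (fun i => h i.castSucc) a)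
        (fun b => h (Fin.last n) b) j

/-- Iterated (parallel) substitution, with a fixed trailing block of size `t`. -/
def Preoperad.psubAux (P : Preoperad) :
    ∀ {n : ℕ} (k : Fin n → ℕ) (t : ℕ), P.C (n + t) → (∀ i, P.C (k i)) → P.C (finSum k + t)
  | 0, _, _, f, _ => f
  | n + 1, k, t, f, g =>
      acast (C := P.C)
        (by simp only [finSum]; omega)
        (P.psubAux (fun i => k i.castSucc) (k (Fin.last n) + t)
          (acast (C := P.C) (by omega) (P.subst n t f (g (Fin.last n))))
          (fun i => g i.castSucc))

/-- Parallel substitution of the elements `g i ∈ C (k i)` into the `n` inputs of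
`f ∈ C n` (performed sequentially; when the `g i` are central the order is
irrelevant). -/
def Preoperad.psub (P : Preoperad) {n : ℕ} (k : Fin n → ℕ) (f : P.C n)
    (g : ∀ i, P.C (k i)) : P.C (finSum k) :=
  P.psubAux k 0 f g

/-- A λ_CLC-structure over a signature: a weakly closed Freyd operad together with
interpretations of all function and procedure symbols. -/
structure CLCStructure (Sg : Sig) where
  O : WCFreydOperad
  Ff : ∀ f : Sg.Func, O.V.C (Sg.fArity f)
  Pp : ∀ p : Sg.Proc, O.C.C (Sg.pArity p)

mutual
/-- Interpretation of values in a λ_CLC-structure: a variable is the identity reindexed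
along discards, function applications are parallel substitutions into the interpretation
of the symbol (followed by contraction of the shared context), and abstractions are
interpreted by the weak closure. -/
def interpV {Sg : Sig} (S : CLCStructure Sg) : ∀ {n : ℕ}, DVal Sg n → S.O.V.C n
  | n, .var i => S.O.V.ren S.O.V.one (fun _ => i)
  | n, .func f args =>
      S.O.V.ren
        (S.O.V.toPreoperad.psub (fun _ => n) (S.Ff f) (fun i => interpV S (args i)))
        (finSumCases (fun _ => n) (fun _ a => a))
  | _, .lam M => S.O.abs (interpC S M)

/-- Interpretation of computations in a λ_CLC-structure: `return` is interpreted by `I`,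
`let` by single substitution in `C` (followed by contraction of the shared context),
procedure applications like function applications, and application via the weak
closure's application element. -/
def interpC {Sg : Sig} (S : CLCStructure Sg) : ∀ {n : ℕ}, DCmp Sg n → S.O.C.C n
  | _, .ret W => S.O.I.map (interpV S W)
  | n, .letin M₁ M₂ =>
      S.O.C.ren (S.O.C.subst n 0 (interpC S M₂) (interpC S M₁)) (copyRen n)
  | n, .proc p args =>
      S.O.C.ren
        (S.O.C.toPreoperad.psub (fun _ => n) (S.Pp p)
          (fun i => S.O.I.map (interpV S (args i))))
        (finSumCases (fun _ => n) (fun _ a => a))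
  | n, .app V₁ V₂ =>
      S.O.C.ren
        (S.O.C.toPreoperad.psub (fun _ : Fin 2 => n) S.O.app
          (fun i => S.O.I.map (Fin.cases (interpV S V₁) (fun _ => interpV S V₂) i)))
        (finSumCases (fun _ : Fin 2 => n) (fun _ a => a))
end

/-- The single substitution `[x := W]` of a value for the last variable. -/
def sub1 {Sg : Sig} {n : ℕ} (W : DVal Sg n) : Fin (n + 1) → DVal Sg n :=
  fun i => Fin.lastCases W (fun j => .var j) i

/-- Weakening inserting a fresh variable just below the last one. -/
def midWeak (n : ℕ) : Fin (n + 1) → Fin (n + 2) :=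
  fun i => Fin.lastCases (Fin.last (n + 1)) (fun j => j.castSucc.castSucc) i

mutual
/-- The equational theory of λ_CLC on values: the least congruence containing the
axioms (lunit), (runit), (assoc) and (beta). -/
inductive EqV (Sg : Sig) : {n : ℕ} → DVal Sg n → DVal Sg n → Prop
  | refl {n : ℕ} (V : DVal Sg n) : EqV Sg V V
  | symm {n : ℕ} {V₁ V₂ : DVal Sg n} : EqV Sg V₁ V₂ → EqV Sg V₂ V₁
  | trans {n : ℕ} {V₁ V₂ V₃ : DVal Sg n} : EqV Sg V₁ V₂ → EqV Sg V₂ V₃ → EqV Sg V₁ V₃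
  | func {n : ℕ} (f : Sg.Func) {args args' : Fin (Sg.fArity f) → DVal Sg n} :
      (∀ i, EqV Sg (args i) (args' i)) → EqV Sg (.func f args) (.func f args')
  | lam {n : ℕ} {M M' : DCmp Sg (n + 1)} : EqC Sg M M' → EqV Sg (.lam M) (.lam M')

/-- The equational theory of λ_CLC on computations. -/
inductive EqC (Sg : Sig) : {n : ℕ} → DCmp Sg n → DCmp Sg n → Prop
  | refl {n : ℕ} (M : DCmp Sg n) : EqC Sg M M
  | symm {n : ℕ} {M₁ M₂ : DCmp Sg n} : EqC Sg M₁ M₂ → EqC Sg M₂ M₁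
  | trans {n : ℕ} {M₁ M₂ M₃ : DCmp Sg n} : EqC Sg M₁ M₂ → EqC Sg M₂ M₃ → EqC Sg M₁ M₃
  | ret {n : ℕ} {W W' : DVal Sg n} : EqV Sg W W' → EqC Sg (.ret W) (.ret W')
  | letin {n : ℕ} {M₁ M₁' : DCmp Sg n} {M₂ M₂' : DCmp Sg (n + 1)} :
      EqC Sg M₁ M₁' → EqC Sg M₂ M₂' → EqC Sg (.letin M₁ M₂) (.letin M₁' M₂')
  | proc {n : ℕ} (p : Sg.Proc) {args args' : Fin (Sg.pArity p) → DVal Sg n} :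
      (∀ i, EqV Sg (args i) (args' i)) → EqC Sg (.proc p args) (.proc p args')
  | app {n : ℕ} {V₁ V₁' V₂ V₂' : DVal Sg n} :
      EqV Sg V₁ V₁' → EqV Sg V₂ V₂' → EqC Sg (.app V₁ V₂) (.app V₁' V₂')
  /-- (lunit) `let x = return W in M ≡ M[x := W]` -/
  | lunit {n : ℕ} (W : DVal Sg n) (M : DCmp Sg (n + 1)) :
      EqC Sg (.letin (.ret W) M) (substC M (sub1 W))
  /-- (runit) `let x = M in return x ≡ M` -/
  | runit {n : ℕ} (M : DCmp Sg n) :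
      EqC Sg (.letin M (.ret (.var (Fin.last n)))) M
  /-- (assoc) `let y = (let x = M₁ in M₂) in M ≡ let x = M₁ in (let y = M₂ in M)` -/
  | assoc {n : ℕ} (M₁ : DCmp Sg n) (M₂ : DCmp Sg (n + 1)) (M : DCmp Sg (n + 1)) :
      EqC Sg (.letin (.letin M₁ M₂) M)
        (.letin M₁ (.letin M₂ (renameC M (midWeak n))))
  /-- (beta) `(λx.M) W ≡ M[x := W]` -/
  | beta {n : ℕ} (M : DCmp Sg (n + 1)) (W : DVal Sg n) :
      EqC Sg (.app (.lam M) W) (substC M (sub1 W))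
end

/-- Embedding of the left block `n₁` into `n₁ + m + n₂`. -/
def embL (n₁ m n₂ : ℕ) : Fin n₁ → Fin (n₁ + m + n₂) :=
  fun j => Fin.castAdd n₂ (Fin.castAdd m j)

/-- Embedding of the middle block `m` into `n₁ + m + n₂`. -/
def embM (n₁ m n₂ : ℕ) : Fin m → Fin (n₁ + m + n₂) :=
  fun a => Fin.castAdd n₂ (Fin.natAdd n₁ a)

/-- Embedding of the right block `n₂` into `n₁ + m + n₂`. -/
def embR (n₁ m n₂ : ℕ) : Fin n₂ → Fin (n₁ + m + n₂) :=
  fun z => Fin.natAdd (n₁ + m) z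

/-- The simultaneous substitution replacing the distinguished middle variable of
`n₁ + 1 + n₂` by `V₂` (placed in the middle block) and renaming the other variables
accordingly. -/
def midSubst {Sg : Sig} (n₁ n₂ : ℕ) {m : ℕ} (V₂ : DVal Sg m) :
    Fin (n₁ + 1 + n₂) → DVal Sg (n₁ + m + n₂) :=
  fun i =>
    Fin.addCases (motive := fun _ => DVal Sg (n₁ + m + n₂))
      (fun j : Fin (n₁ + 1) =>
        Fin.lastCases (renameV V₂ (embM n₁ m n₂)) (fun j' => .var (embL n₁ m n₂ j')) j)
      (fun z : Fin n₂ => .var (embR n₁ m n₂ z)) i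

/-- Single substitution of a value into the distinguished middle variable of a value. -/
def tsubV {Sg : Sig} (n₁ n₂ : ℕ) {m : ℕ} (V₁ : DVal Sg (n₁ + 1 + n₂)) (V₂ : DVal Sg m) :
    DVal Sg (n₁ + m + n₂) :=
  substV V₁ (midSubst n₁ n₂ V₂)

/-- Renaming sending the distinguished middle variable of `n₁ + 1 + n₂` to the last
variable of `(n₁ + m + n₂) + 1` and the remaining variables to the corresponding
blocks. -/
def midToLast (n₁ n₂ m : ℕ) : Fin (n₁ + 1 + n₂) → Fin (n₁ + m + n₂ + 1) :=
  fun i =>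
    Fin.addCases (motive := fun _ => Fin (n₁ + m + n₂ + 1))
      (fun j : Fin (n₁ + 1) =>
        Fin.lastCases (Fin.last (n₁ + m + n₂)) (fun j' => (embL n₁ m n₂ j').castSucc) j)
      (fun z : Fin n₂ => (embR n₁ m n₂ z).castSucc) i

/-- Single substitution of a computation into the distinguished middle variable of a
computation, given by sequencing: `let y = M₂ in M₁`. -/
def tletC {Sg : Sig} (n₁ n₂ : ℕ) {m : ℕ} (M₁ : DCmp Sg (n₁ + 1 + n₂)) (M₂ : DCmp Sg m) :
    DCmp Sg (n₁ + m + n₂) :=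
  .letin (renameC M₂ (embM n₁ m n₂)) (renameC M₁ (midToLast n₁ n₂ m))

/-- `S` is a term model of λ_CLC: its carriers are equivalence classes of well-formed
terms modulo provable equality, with single substitution given by value substitution
(resp. `let`-sequencing), reindexing by syntactic renaming, `I` by `return`, abstraction
by `λ`, application by the class of `x₁ x₂`, and symbol interpretations by their
canonical terms. -/
def IsTermModel {Sg : Sig} (S : CLCStructure Sg)
    (eV : ∀ n : ℕ, S.O.V.C n ≃ Quot (@EqV Sg n)) (eC : ∀ n : ℕ, S.O.C.C n ≃ Quot (@EqC Sg n)) :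
    Prop :=
  (eV 1 S.O.V.one = Quot.mk _ (.var 0)) ∧
  (eC 1 S.O.C.one = Quot.mk _ (.ret (.var 0))) ∧
  (∀ {n₁ n₂ m : ℕ} (V₁ : DVal Sg (n₁ + 1 + n₂)) (V₂ : DVal Sg m),
    eV _ (S.O.V.subst n₁ n₂ ((eV _).symm (Quot.mk _ V₁)) ((eV _).symm (Quot.mk _ V₂))) =
      Quot.mk _ (tsubV n₁ n₂ V₁ V₂)) ∧
  (∀ {n₁ n₂ m : ℕ} (M₁ : DCmp Sg (n₁ + 1 + n₂)) (M₂ : DCmp Sg m),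
    eC _ (S.O.C.subst n₁ n₂ ((eC _).symm (Quot.mk _ M₁)) ((eC _).symm (Quot.mk _ M₂))) =
      Quot.mk _ (tletC n₁ n₂ M₁ M₂)) ∧
  (∀ {m n : ℕ} (V : DVal Sg m) (r : Ren m n),
    eV _ (S.O.V.ren ((eV _).symm (Quot.mk _ V)) r) = Quot.mk _ (renameV V r)) ∧
  (∀ {m n : ℕ} (M : DCmp Sg m) (r : Ren m n),
    eC _ (S.O.C.ren ((eC _).symm (Quot.mk _ M)) r) = Quot.mk _ (renameC M r)) ∧
  (∀ {n : ℕ} (V : DVal Sg n),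
    eC _ (S.O.I.map ((eV _).symm (Quot.mk _ V))) = Quot.mk _ (.ret V)) ∧
  (∀ {n : ℕ} (M : DCmp Sg (n + 1)),
    eV _ (S.O.abs ((eC _).symm (Quot.mk _ M))) = Quot.mk _ (.lam M)) ∧
  (eC 2 S.O.app = Quot.mk _ (.app (.var 0) (.var 1))) ∧
  (∀ f : Sg.Func, eV _ (S.Ff f) = Quot.mk _ (.func f (fun i => .var i))) ∧
  (∀ p : Sg.Proc, eC _ (S.Pp p) = Quot.mk _ (.proc p (fun i => .var i)))

/-- A morphism of λ_CLC-structures: a pair of cartesian preoperad functors commuting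
with the functors `I`, preserving abstraction and application, and preserving the
interpretations of all function and procedure symbols. -/
structure CLCHom {Sg : Sig} (S₁ S₂ : CLCStructure Sg) where
  mapV : RenPreoperadHom S₁.O.V.toRenPreoperad S₂.O.V.toRenPreoperad
  mapC : RenPreoperadHom S₁.O.C.toRenPreoperad S₂.O.C.toRenPreoperad
  squareI : ∀ {n : ℕ} (v : S₁.O.V.C n), mapC.map (S₁.O.I.map v) = S₂.O.I.map (mapV.map v)
  mapAbs : ∀ {n : ℕ} (f : S₁.O.C.C (n + 1)), mapV.map (S₁.O.abs f) = S₂.O.abs (mapC.map f)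
  mapApp : mapC.map S₁.O.app = S₂.O.app
  mapFf : ∀ f : Sg.Func, mapV.map (S₁.Ff f) = S₂.Ff f
  mapPp : ∀ p : Sg.Proc, mapC.map (S₁.Pp p) = S₂.Pp p

section Renamings

theorem nat_lt_true {a b : ℕ} (h : a < b) : (a < b) = True := eq_true h

theorem nat_lt_false {a b : ℕ} (h : b ≤ a) : (a < b) = False := eq_false (by omega)

theorem nat_eq_true {a b : ℕ} (h : a = b) : (a = b) = True := eq_true h

theorem nat_eq_false {a b : ℕ} (h : a ≠ b) : (a = b) = False := eq_false h

theorem bsum_val {m₁ n₁ m₂ n₂ : ℕ} (r : Ren m₁ n₁) (r' : Ren m₂ n₂) (i : Fin (m₁ + m₂)) :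
    (bsum r r' i).val =
      if h : i.val < m₁ then (r ⟨i, h⟩).val else n₁ + (r' ⟨i - m₁, by omega⟩).val := by
  refine Fin.addCases (fun a => ?_) (fun b => ?_) i
  · simp [bsum]
  · simp [bsum]

theorem liftRen_val {m n : ℕ} (r : Fin m → Fin n) (i : Fin (m + 1)) :
    (liftRen r i).val = if h : i.val < m then (r ⟨i, h⟩).val else n := by
  refine Fin.lastCases ?_ (fun a => ?_) i
  · simp [liftRen]
  · simp [liftRen]

theorem copyRen_val {n : ℕ} (i : Fin (n + n)) :
    (copyRen n i).val = if i.val < n then i.val else i.val - n := by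
  refine Fin.addCases (fun a => ?_) (fun b => ?_) i
  · simp [copyRen]
  · simp only [copyRen, Fin.addCases_right, Fin.val_natAdd]
    split_ifs <;> omega

theorem swapRen_val {m n : ℕ} (i : Fin (m + n)) :
    (swapRen m n i).val = if i.val < m then n + i.val else i.val - m := by
  refine Fin.addCases (fun a => ?_) (fun b => ?_) i
  · simp [swapRen]
  · simp [swapRen]

theorem midToLast_val {n₁ n₂ m : ℕ} (i : Fin (n₁ + 1 + n₂)) :
    (midToLast n₁ n₂ m i).val =
      if i.val < n₁ then i.val else if i.val = n₁ then n₁ + m + n₂ else i.val - 1 + m := by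
  refine Fin.addCases (fun a => ?_) (fun b => ?_) i
  · refine Fin.lastCases ?_ (fun a => ?_) a
    · simp [midToLast]
    · simp [midToLast, embL]
  · simp only [midToLast, Fin.addCases_right, embR, Fin.val_castSucc, Fin.val_natAdd]
    split_ifs <;> omega

theorem embM_val {n₁ m n₂ : ℕ} (i : Fin m) : (embM n₁ m n₂ i).val = n₁ + i.val := rfl

@[simp] theorem liftRen_castSucc {m n : ℕ} (r : Fin m → Fin n) (i : Fin m) :
    liftRen r i.castSucc = (r i).castSucc := by simp [liftRen]

@[simp] theorem liftRen_last {m n : ℕ} (r : Fin m → Fin n) :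
    liftRen r (Fin.last m) = Fin.last n := by simp [liftRen]

/-- The renaming exchanging the last two variables. -/
def swapLast (p : ℕ) : Ren (p + 2) (p + 2) :=
  fun i => ⟨if i.val < p then i.val else if i.val = p then p + 1 else p, by split_ifs <;> omega⟩

theorem swapLast_val {p : ℕ} (i : Fin (p + 2)) :
    (swapLast p i).val = if i.val < p then i.val else if i.val = p then p + 1 else p := rfl

end Renamings

section Instantiation

variable (P : SymRenPreoperad)

theorem acast_eq_ren {m n : ℕ} (h : m = n) (x : P.C m) :
    acast (C := P.C) h x = P.ren x (Fin.cast h) := by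
  subst h
  exact (P.ren_id x).symm

theorem ren_congr {m n : ℕ} {r r' : Ren m n} (f : P.C m) (h : ∀ i, (r i).val = (r' i).val) :
    P.ren f r = P.ren f r' := by
  congr 1
  funext i
  exact Fin.ext (h i)

theorem ren_eq_self {m : ℕ} {r : Ren m m} (f : P.C m) (h : ∀ i, (r i).val = i.val) :
    P.ren f r = f :=
  (ren_congr P f h).trans (P.ren_id f)

/-- Substitution into the last input. -/
def plugLast {p q : ℕ} (x : P.C (p + 1)) (u : P.C q) : P.C (p + q) := P.subst p 0 x u

/-- Instantiation `x[last := u]` of the last variable in a shared context. -/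
def inst {p : ℕ} (x : P.C (p + 1)) (u : P.C p) : P.C p :=
  P.ren (plugLast P x u) (copyRen p)

theorem plugLast_ren_ren {n k m₁ m : ℕ} (f : P.C (n + 1)) (g : P.C k)
    (r₁ : Ren n m₁) (r : Ren k m) :
    plugLast P (P.ren f (liftRen r₁)) (P.ren g r) = P.ren (plugLast P f g) (bsum r₁ r) := by
  have h := P.ren_subst (n₂ := 0) (m₂ := 0) f g r₁ r (idRen 0)
  refine Eq.trans ?_ (h.symm.trans (ren_congr P _ fun i => ?_))
  · refine congrArg (fun z => P.subst m₁ 0 z (P.ren g r)) (ren_congr P _ fun i => ?_)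
    have := i.isLt
    simp only [liftRen_val, bsum_val, idRen]
    split_ifs <;> omega
  · have := i.isLt
    simp only [bsum_val, idRen]
    split_ifs <;> first | rfl | omega

theorem inst_ren_ren {n k p : ℕ} (f : P.C (n + 1)) (g : P.C k) (a : Ren n p) (b : Ren k p) :
    inst P (P.ren f (liftRen a)) (P.ren g b) =
      P.ren (plugLast P f g) (copyRen p ∘ bsum a b) := by
  rw [inst, plugLast_ren_ren, P.ren_comp]

theorem ren_inst {p q : ℕ} (x : P.C (p + 1)) (u : P.C p) (r : Ren p q) :
    P.ren (inst P x u) r = inst P (P.ren x (liftRen r)) (P.ren u r) := by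
  rw [inst_ren_ren, inst, ← P.ren_comp]
  refine ren_congr P _ fun i => ?_
  refine Fin.addCases (fun a => ?_) (fun b => ?_) i <;>
    simp only [copyRen, bsum, Function.comp, Fin.addCases_left, Fin.addCases_right]

theorem subst_eq_inst {n₂ : ℕ} : ∀ {n₁ m : ℕ} (f : P.C (n₁ + 1 + n₂)) (g : P.C m),
    P.subst n₁ n₂ f g =
      inst P (P.ren f (midToLast n₁ n₂ m)) (P.ren g (embM n₁ m n₂)) := by
  induction n₂ with
  | zero =>
    intro n₁ m f g
    have h : P.ren f (midToLast n₁ 0 m) = P.ren f (liftRen (Fin.castAdd m)) := by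
      refine ren_congr P _ fun i => ?_
      have := i.isLt
      simp only [liftRen_val, midToLast_val, Fin.val_castAdd]
      split_ifs <;> omega
    refine Eq.trans ?_ (congrArg (fun z => inst P z (P.ren g (embM n₁ m 0))) h.symm)
    refine Eq.trans ?_ (inst_ren_ren P f g _ _).symm
    refine (ren_eq_self P _ fun i => ?_).symm
    have := i.isLt
    simp only [Function.comp, copyRen_val, bsum_val, embM_val, Fin.val_castAdd]
    split_ifs <;> omega
  | succ n₂ ih =>
    have e : n₂ + 1 = 1 + n₂ := by omega
    rw [e]
    intro n₁ m f g
    let f' : P.C (n₁ + 2 + n₂) := P.ren (P.ren f (Fin.cast (by omega)))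
      (bsum (bsum (idRen n₁) (swapRen 1 1)) (idRen n₂))
    have hf : acast (C := P.C) (by omega)
        (P.ren f' (bsum (bsum (idRen n₁) (swapRen 1 1)) (idRen n₂))) = f := by
      rw [acast_eq_ren]
      simp only [f']
      rw [← P.ren_comp, ← P.ren_comp, ← P.ren_comp]
      refine ren_eq_self P _ fun i => ?_
      have := i.isLt
      rcases (by omega : i.val < n₁ ∨ i.val = n₁ ∨ i.val = n₁ + 1 ∨ n₁ + 1 < i.val)
        with hi | hi | hi | hi <;>
      simp (disch := omega) only [Function.comp, bsum_val, idRen, swapRen_val, Fin.val_cast,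
        nat_lt_true, nat_lt_false, nat_eq_true, dite_true, dite_false, if_true,
        if_false]
    have h := P.sym_nat₁ (m₁ := n₁) (m₂ := n₂) f' g
    rw [hf] at h
    rw [h, ih, acast_eq_ren, acast_eq_ren, ← P.ren_comp, ← P.ren_comp, ren_inst]
    simp only [f']
    rw [← P.ren_comp, ← P.ren_comp, ← P.ren_comp, ← P.ren_comp]
    congr 1
    · refine ren_congr P _ fun i => ?_
      have := i.isLt
      rcases (by omega : i.val < n₁ ∨ i.val = n₁ ∨ i.val = n₁ + 1 ∨ n₁ + 1 < i.val)
        with hi | hi | hi | hi <;>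
      simp (disch := omega) only [Function.comp, bsum_val, idRen, swapRen_val, Fin.val_cast,
        liftRen_val, midToLast_val,
        nat_lt_true, nat_lt_false, nat_eq_true, nat_eq_false, dite_true, dite_false, if_true,
        if_false]
    · refine ren_congr P _ fun i => ?_
      have := i.isLt
      simp (disch := omega) only [Function.comp, bsum_val, idRen, swapRen_val, Fin.val_cast,
        embM_val, nat_lt_true, nat_lt_false, nat_eq_true, dite_true, dite_false,
        if_false]

theorem plugLast_one {p : ℕ} (x : P.C (p + 1)) : plugLast P x P.one = x :=
  P.right_unit (n₁ := p) (n₂ := 0) x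

theorem one_plugLast {p : ℕ} (u : P.C p) :
    plugLast P (p := 0) P.one u = P.ren u (Fin.cast (by omega)) := by
  rw [← acast_eq_ren]
  exact P.left_unit u

theorem plugLast_plugLast {p q m : ℕ} (x : P.C (p + 1)) (u : P.C (q + 1)) (v : P.C m) :
    plugLast P (p := p + q) (plugLast P (q := q + 1) x u) v =
      P.ren (plugLast P (q := q + m) x (plugLast P u v)) (Fin.cast (by omega)) := by
  rw [← acast_eq_ren]
  exact P.assoc (m₁ := p) (m₂ := 0) (n₁ := q) (n₂ := 0) x u v

/-- The renaming merging the last variable into `i`. -/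
def mergeLast {p : ℕ} (i : Fin p) : Ren (p + 1) p :=
  fun j => if h : j.val < p then ⟨j, h⟩ else i

theorem mergeLast_val {p : ℕ} (i : Fin p) (j : Fin (p + 1)) :
    (mergeLast i j).val = if j.val < p then j.val else i.val := by
  unfold mergeLast
  split_ifs <;> rfl

theorem inst_var {p : ℕ} (x : P.C (p + 1)) (i : Fin p) :
    inst P x (P.ren P.one (fun _ => i)) = P.ren x (mergeLast i) := by
  have hx : x = P.ren x (liftRen (idRen p)) :=
    (ren_eq_self P x fun i => by simp only [liftRen_val, idRen]; split_ifs <;> omega).symm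
  conv_lhs => rw [hx]
  rw [inst_ren_ren, plugLast_one]
  refine ren_congr P _ fun j => ?_
  simp only [Function.comp, copyRen_val, bsum_val, mergeLast_val, idRen]
  split_ifs <;> omega

theorem inst_one_last {p : ℕ} (u : P.C p) :
    inst P (P.ren P.one (fun _ => Fin.last p)) u = u := by
  have h₁ : P.ren P.one (fun _ => Fin.last p) =
      P.ren (m := 0 + 1) P.one (liftRen (discardRen p)) :=
    ren_congr P _ fun j => by
      have := j.isLt
      simp only [liftRen_val]
      split_ifs <;> first | rfl | omega
  have h₂ := inst_ren_ren P (n := 0) P.one u (discardRen p) (idRen p)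
  rw [P.ren_id, one_plugLast, ← P.ren_comp] at h₂
  refine (congrArg (fun z => inst P z u) h₁).trans (h₂.trans (ren_eq_self P u fun j => ?_))
  simp only [Function.comp, copyRen_val, bsum_val, idRen, Fin.val_cast]
  split_ifs <;> omega

theorem inst_inst_weaken {p : ℕ} (x u : P.C (p + 1)) (v : P.C p) :
    inst P (inst P (P.ren x (liftRen Fin.castSucc)) u) v = inst P x (inst P u v) := by
  have h₁ := inst_ren_ren P x u (p := p + 1) Fin.castSucc (idRen (p + 1))
  rw [P.ren_id] at h₁
  have h₂ : P.ren (plugLast P x u) (copyRen (p + 1) ∘ bsum Fin.castSucc (idRen (p + 1))) =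
      P.ren (m := p + p + 1) (plugLast P (q := p + 1) x u) (liftRen (copyRen p)) := by
    refine ren_congr P _ fun j => ?_
    have := j.isLt
    simp only [Function.comp, copyRen_val, bsum_val, idRen, liftRen_val, Fin.val_castSucc]
    split_ifs <;> omega
  have h₃ := inst_ren_ren P (n := p + p) (plugLast P (q := p + 1) x u) v (copyRen p) (idRen p)
  rw [P.ren_id, plugLast_plugLast] at h₃
  rw [h₁, h₂, h₃, ← P.ren_comp]
  have h₄ := plugLast_ren_ren P x (plugLast P u v) (idRen p) (copyRen p)
  have h₅ : P.ren x (liftRen (idRen p)) = x :=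
    ren_eq_self P x fun i => by simp only [liftRen_val, idRen]; split_ifs <;> omega
  rw [h₅] at h₄
  rw [inst, inst, h₄, ← P.ren_comp]
  refine ren_congr P _ fun j => ?_
  have := j.isLt
  simp only [Function.comp, copyRen_val, bsum_val, idRen, Fin.val_cast]
  split_ifs <;> omega

set_option maxHeartbeats 1000000 in
theorem inst_comm_of_central {p : ℕ} {v : P.C p} (hv : P.toPreoperad.Central v)
    (x : P.C (p + 2)) (u : P.C p) :
    inst P (inst P x (P.ren u Fin.castSucc)) v =
      inst P (inst P (P.ren x (swapLast p)) (P.ren v Fin.castSucc)) u := by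
  have h := (hv u p 0 0 x).1
  have h' := congrArg (fun z => P.ren z
    (fun i => (⟨if i.val < p then i.val else if i.val < p + p then i.val - p else i.val - (p + p),
      by have := i.isLt; split_ifs <;> omega⟩ : Fin p))) h
  simp only [subst_eq_inst, acast_eq_ren, ren_inst, ← P.ren_comp] at h'
  refine Eq.trans ?_ (h'.symm.trans ?_) <;> congr 1
  · congr 1 
    · refine (ren_eq_self P _ fun j => ?_).symm
      have := j.isLt
      rcases (by omega : j.val < p ∨ j.val = p ∨ p < j.val) with hj | hj | hj <;>
      simp (disch := omega) only [Function.comp, liftRen_val, midToLast_val, Fin.val_cast,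
        nat_lt_true, nat_lt_false, nat_eq_true, nat_eq_false, dite_true, dite_false, if_true,
        if_false]
    · refine ren_congr P _ fun j => ?_
      have := j.isLt
      rcases (by omega : j.val < p ∨ j.val = p ∨ p < j.val) with hj | hj | hj <;>
      simp (disch := omega) only [Function.comp, liftRen_val, midToLast_val, embM_val, Fin.val_cast, Fin.val_castSucc,
        nat_lt_true, nat_lt_false, nat_eq_true, nat_eq_false, dite_true, if_true,
        if_false]
  · refine (ren_eq_self P _ fun j => ?_).symm
    have := j.isLt
    rcases (by omega : j.val < p ∨ j.val = p ∨ p < j.val) with hj | hj | hj <;>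
    simp (disch := omega) only [Function.comp, embM_val, Fin.val_cast,
      nat_lt_true, nat_lt_false, nat_eq_true, if_true,
      if_false]
  · congr 1 
    · refine ren_congr P _ fun j => ?_
      have := j.isLt
      rcases (by omega : j.val < p ∨ j.val = p ∨ p < j.val) with hj | hj | hj <;>
      simp (disch := omega) only [Function.comp, liftRen_val, midToLast_val, Fin.val_cast, swapLast_val,
        nat_lt_true, nat_lt_false, nat_eq_true, nat_eq_false, dite_true, dite_false, if_true,
        if_false]
    · refine ren_congr P _ fun j => ?_
      have := j.isLt
      rcases (by omega : j.val < p ∨ j.val = p ∨ p < j.val) with hj | hj | hj <;>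
      simp (disch := omega) only [Function.comp, liftRen_val, midToLast_val, embM_val, Fin.val_cast, Fin.val_castSucc,
        nat_lt_true, nat_lt_false, nat_eq_true, nat_eq_false, dite_true, if_true,
        if_false]
  · refine ren_eq_self P _ fun j => ?_
    have := j.isLt
    rcases (by omega : j.val < p ∨ j.val = p ∨ p < j.val) with hj | hj | hj <;>
    simp (disch := omega) only [Function.comp, embM_val,
      nat_lt_true, nat_lt_false, nat_eq_true, if_true,
      if_false]

/-- A class of elements, closed under reindexing and instantiation, that may be discarded,
copied and commuted past arbitrary elements. -/
structure ValueClass (K : ∀ {n : ℕ}, P.C n → Prop) : Prop where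
  one : K P.one
  ren : ∀ {m n : ℕ} {v : P.C m} (r : Ren m n), K v → K (P.ren v r)
  inst : ∀ {p : ℕ} {u : P.C (p + 1)} {v : P.C p}, K u → K v → K (inst P u v)
  comm : ∀ {p : ℕ} {v : P.C p}, K v → ∀ (x : P.C (p + 2)) (u : P.C p),
    _root_.inst P (_root_.inst P x (P.ren u Fin.castSucc)) v =
      _root_.inst P (_root_.inst P (P.ren x (swapLast p)) (P.ren v Fin.castSucc)) u
  discard : ∀ {p : ℕ} {v : P.C p}, K v → ∀ x : P.C p,
    _root_.inst P (P.ren x Fin.castSucc) v = x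
  copy : ∀ {p : ℕ} {v : P.C p}, K v → ∀ x : P.C (p + 2),
    _root_.inst P (P.ren x (mergeLast (Fin.last p))) v =
      _root_.inst P (_root_.inst P x (P.ren v Fin.castSucc)) v

end Instantiation

theorem CartOperad.inst_discard (V : CartOperad) {p : ℕ} (v : V.C p) (x : V.C p) :
    inst V.toSymRenPreoperad (V.ren x Fin.castSucc) v = x := by
  have h := V.discard_nat (m₁ := p) (m₂ := 0) x v
  have h₁ : V.ren x Fin.castSucc =
      V.ren x (bsum (bsum (idRen p) (discardRen 1)) (idRen 0) : Ren (p + 0 + 0) (p + 1 + 0)) := by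
    refine ren_congr V.toSymRenPreoperad _ fun j => ?_
    have := j.isLt
    simp only [bsum_val, idRen, Fin.val_castSucc]
    split_ifs <;> first | rfl | omega
  rw [inst, plugLast]
  refine (congrArg (fun z => V.ren (V.subst p 0 z v) (copyRen p)) h₁).trans ?_
  refine (congrArg (fun z => V.ren (n := p) z (copyRen p)) h).trans ?_
  refine (V.ren_comp _ _ _).symm.trans (ren_eq_self V.toSymRenPreoperad _ fun j => ?_)
  have := j.isLt
  refine (copyRen_val _).trans ?_
  simp only [bsum_val, idRen]
  split_ifs <;> first | rfl | omega

set_option maxHeartbeats 1000000 in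
theorem CartOperad.inst_copy (V : CartOperad) {p : ℕ} (v : V.C p) (x : V.C (p + 2)) :
    inst V.toSymRenPreoperad (V.ren x (mergeLast (Fin.last p))) v =
      inst V.toSymRenPreoperad (inst V.toSymRenPreoperad x (V.ren v Fin.castSucc)) v := by
  have h := congrArg (fun z => V.ren z (copyRen p)) (V.copy_nat (m₁ := p) (m₂ := 0) x v)
  simp only [subst_eq_inst V.toSymRenPreoperad, acast_eq_ren V.toSymRenPreoperad,
    ren_inst V.toSymRenPreoperad, ← V.ren_comp] at h
  refine Eq.trans ?_ (h.trans ?_) <;> congr 1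
  · refine ren_congr V.toSymRenPreoperad _ fun j => ?_
    have := j.isLt
    rcases (by omega : j.val < p ∨ j.val = p ∨ p < j.val) with hj | hj | hj <;>
    simp (disch := omega) only [Function.comp, liftRen_val, midToLast_val, copyRen_val, bsum_val, idRen, mergeLast_val, Fin.val_last,
      nat_lt_true, nat_lt_false, nat_eq_true, nat_eq_false, dite_true, dite_false, if_true,
      if_false]
  · refine (ren_eq_self V.toSymRenPreoperad _ fun j => ?_).symm
    have := j.isLt
    rcases (by omega : j.val < p ∨ j.val = p ∨ p < j.val) with hj | hj | hj <;>
    simp (disch := omega) only [Function.comp, copyRen_val, embM_val,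
      nat_lt_true, nat_lt_false, nat_eq_true, if_true,
      if_false]
  · congr 1
    · refine ren_eq_self V.toSymRenPreoperad _ fun j => ?_
      have := j.isLt
      rcases (by omega : j.val < p ∨ j.val = p ∨ p < j.val) with hj | hj | hj <;>
      simp (disch := omega) only [Function.comp, liftRen_val, midToLast_val, copyRen_val, bsum_val, idRen, Fin.val_cast,
        nat_lt_true, nat_lt_false, nat_eq_true, nat_eq_false, dite_true, dite_false, if_true,
        if_false]
    · refine ren_congr V.toSymRenPreoperad _ fun j => ?_
      have := j.isLt
      rcases (by omega : j.val < p ∨ j.val = p ∨ p < j.val) with hj | hj | hj <;>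
      simp (disch := omega) only [Function.comp, liftRen_val, midToLast_val, copyRen_val, bsum_val, idRen, embM_val, Fin.val_cast, Fin.val_castSucc,
        nat_lt_true, nat_lt_false, nat_eq_true, nat_eq_false, dite_true, dite_false, if_true,
        if_false]
  · refine ren_eq_self V.toSymRenPreoperad _ fun j => ?_
    have := j.isLt
    rcases (by omega : j.val < p ∨ j.val = p ∨ p < j.val) with hj | hj | hj <;>
    simp (disch := omega) only [Function.comp, copyRen_val, bsum_val, idRen, embM_val, Fin.val_cast,
      nat_lt_true, nat_lt_false, nat_eq_true, dite_true, dite_false, if_true,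
      if_false]

theorem CartOperad.valueClass (V : CartOperad) :
    ValueClass V.toSymRenPreoperad (fun _ => True) where
  one := trivial
  ren _ _ := trivial
  inst _ _ := trivial
  comm _ := inst_comm_of_central _ (V.central _)
  discard _ := V.inst_discard _
  copy _ := V.inst_copy _

section Freyd

variable (F : WCFreydOperad)

theorem map_inst {p : ℕ} (x : F.V.C (p + 1)) (u : F.V.C p) :
    F.I.map (inst F.V.toSymRenPreoperad x u) =
      inst F.C (F.I.map x) (F.I.map u) := by
  rw [inst, F.I.map_ren]
  exact congrArg (fun z => F.C.ren z (copyRen p)) (F.I.map_subst (n₁ := p) (n₂ := 0) x u)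

theorem inst_discard_map {p : ℕ} (v : F.V.C p) (x : F.C.C p) :
    inst F.C (F.C.ren x Fin.castSucc) (F.I.map v) = x := by
  have hx := inst_one_last F.C (F.C.ren x Fin.castSucc)
  rw [← hx, inst_comm_of_central F.C (F.I_central v)]
  have h : F.C.ren (F.C.ren F.C.one (fun _ => Fin.last (p + 1))) (swapLast p) =
      F.I.map (F.V.ren (F.V.ren F.V.one (fun _ => Fin.last p)) Fin.castSucc) := by
    rw [F.I.map_ren, F.I.map_ren, F.I.map_one, ← F.C.ren_comp, ← F.C.ren_comp]
    exact ren_congr F.C _ fun _ => by simp [swapLast_val]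
  rw [h, ← F.I.map_ren, ← map_inst, F.V.inst_discard, F.I.map_ren, F.I.map_one, inst_one_last]

/-- The computation `x ↦ e x` applying a value to a fresh last variable. -/
def applied {q : ℕ} (e : F.V.C q) : F.C.C (q + 1) :=
  inst F.C
    (F.C.ren F.app (fun i => if i.val = 0 then Fin.last (q + 1) else (Fin.last q).castSucc))
    (F.I.map (F.V.ren e Fin.castSucc))

theorem applied_abs {q : ℕ} (f : F.C.C (q + 1)) : applied F (F.abs f) = f := by
  have h := congrArg (fun z => F.C.ren z (Fin.cast (by omega : 0 + q + 1 = q + 1))) (F.beta f)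
  simp only [subst_eq_inst F.C (n₁ := 0) (n₂ := 1), acast_eq_ren F.C, ren_inst,
    ← F.C.ren_comp] at h
  refine Eq.trans ?_ (h.trans ?_)
  · rw [applied, F.I.map_ren]
    congr 1
    · refine ren_congr F.C _ fun j => ?_
      have := j.isLt
      rcases (by omega : j.val = 0 ∨ j.val = 1) with hj | hj <;>
      simp (disch := omega) [Function.comp, liftRen_val, midToLast_val, hj]
    · refine ren_congr F.C _ fun j => ?_
      simp [embM_val]
  · exact ren_eq_self F.C _ fun j => rfl

theorem ren_applied {q s : ℕ} (e : F.V.C q) (r : Ren q s) :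
    F.C.ren (applied F e) (liftRen r) = applied F (F.V.ren e r) := by
  rw [applied, ren_inst, applied, F.I.map_ren, F.I.map_ren, F.I.map_ren, ← F.C.ren_comp,
    ← F.C.ren_comp, ← F.C.ren_comp]
  congr 1
  · refine ren_congr F.C _ fun j => ?_
    simp only [Function.comp]
    split_ifs <;> simp
  · exact ren_congr F.C _ fun j => by simp

theorem applied_inst {q : ℕ} (e : F.V.C (q + 1)) (v : F.V.C q) :
    applied F (inst F.V.toSymRenPreoperad e v) =
      inst F.C (F.C.ren (applied F e) (swapLast q)) (F.C.ren (F.I.map v) Fin.castSucc) := by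
  have h₁ : F.C.ren (F.C.ren F.app
        (fun i => if i.val = 0 then Fin.last (q + 1 + 1) else (Fin.last (q + 1)).castSucc))
        (liftRen (swapLast q)) =
      F.C.ren (F.C.ren F.app
        (fun i => if i.val = 0 then Fin.last (q + 1) else (Fin.last q).castSucc))
        (liftRen Fin.castSucc) := by
    rw [← F.C.ren_comp, ← F.C.ren_comp]
    refine ren_congr F.C _ fun j => ?_
    simp only [Function.comp]
    split_ifs <;> simp [swapLast_val]
  rw [applied, applied, ren_inst F.C, h₁, inst_inst_weaken, ren_inst F.V.toSymRenPreoperad, map_inst]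
  simp only [F.I.map_ren, ← F.C.ren_comp]
  congr 2
  refine ren_congr F.C _ fun j => ?_
  have := j.isLt
  simp only [Function.comp, liftRen_val, swapLast_val, Fin.val_castSucc]
  split_ifs <;> omega

theorem inst_copy_map {p : ℕ} (v : F.V.C p) (x : F.C.C (p + 2)) :
    inst F.C (F.C.ren x (mergeLast (Fin.last p))) (F.I.map v) =
      inst F.C (inst F.C x (F.C.ren (F.I.map v) Fin.castSucc)) (F.I.map v) := by
  suffices h : F.C.ren (inst F.C (F.C.ren x (mergeLast (Fin.last p))) (F.I.map v)) Fin.castSucc =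
      F.C.ren (inst F.C (inst F.C x (F.C.ren (F.I.map v) Fin.castSucc)) (F.I.map v))
        Fin.castSucc by
    have h' := congrArg (fun z => inst F.C z (F.I.map v)) h
    simpa only [inst_discard_map] using h'
  have he : applied F (F.abs (F.C.ren x Fin.castSucc)) = F.C.ren x Fin.castSucc :=
    applied_abs F _
  generalize F.abs (F.C.ren x Fin.castSucc) = e at he
  have h := congrArg (applied F) (F.V.inst_copy v e)
  rw [applied_inst, applied_inst, applied_inst, ← ren_applied, he] at h
  rw [F.I.map_ren] at h
  simp only [ren_inst, ← F.C.ren_comp] at h ⊢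
  refine Eq.trans ?_ (h.trans ?_) <;> congr 1
  · refine ren_congr F.C _ fun j => ?_
    have := j.isLt
    rcases (by omega : j.val < p ∨ j.val = p ∨ p < j.val) with hj | hj | hj <;>
    simp (disch := omega) only [Function.comp, liftRen_val, mergeLast_val, swapLast_val,
      Fin.val_castSucc, Fin.val_last, nat_lt_true, nat_lt_false, nat_eq_true, nat_eq_false,
      dite_true, dite_false, if_true, if_false]
  · congr 1
    · refine ren_congr F.C _ fun j => ?_
      have := j.isLt
      rcases (by omega : j.val < p ∨ j.val = p ∨ p < j.val) with hj | hj | hj <;>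
      simp (disch := omega) only [Function.comp, liftRen_val, swapLast_val,
        Fin.val_castSucc, nat_lt_true, nat_lt_false, nat_eq_true, nat_eq_false,
        dite_true, dite_false, if_true, if_false]
    · refine ren_congr F.C _ fun j => ?_
      have := j.isLt
      simp (disch := omega) only [Function.comp, liftRen_val, swapLast_val,
        Fin.val_castSucc, nat_lt_true, dite_true, if_true]

theorem WCFreydOperad.valueClass :
    ValueClass F.C (fun {n} x => ∃ v : F.V.C n, x = F.I.map v) where
  one := ⟨F.V.one, F.I.map_one.symm⟩
  ren := by
    rintro _ _ _ r ⟨v, rfl⟩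
    exact ⟨F.V.ren v r, (F.I.map_ren v r).symm⟩
  inst := by
    rintro _ _ _ ⟨u, rfl⟩ ⟨v, rfl⟩
    exact ⟨_, (map_inst F u v).symm⟩
  comm := by
    rintro _ _ ⟨v, rfl⟩
    exact inst_comm_of_central _ (F.I_central v)
  discard := by
    rintro _ _ ⟨v, rfl⟩
    exact inst_discard_map F v
  copy := by
    rintro _ _ ⟨v, rfl⟩
    exact inst_copy_map F v

end Freyd

section Simultaneous

variable (P : SymRenPreoperad)

theorem ValueClass.inst_inst {P : SymRenPreoperad} {K : ∀ {n : ℕ}, P.C n → Prop}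
    (hK : ValueClass P @K) {p : ℕ} (x : P.C (p + 2)) (u : P.C (p + 1)) {v : P.C p} (hv : K v) :
    _root_.inst P (_root_.inst P x u) v =
      _root_.inst P (_root_.inst P (P.ren x (swapLast p)) (P.ren v Fin.castSucc))
        (_root_.inst P u v) := by
  have h : _root_.inst P x u =
      P.ren (_root_.inst P (P.ren x (liftRen Fin.castSucc)) (P.ren u (liftRen Fin.castSucc)))
        (mergeLast (Fin.last p)) := by
    rw [ren_inst, ← P.ren_comp, ← P.ren_comp]
    congr 1
    · refine (ren_eq_self P _ fun j => ?_).symm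
      have := j.isLt
      simp only [Function.comp, liftRen_val, mergeLast_val, Fin.val_castSucc, Fin.val_last]
      split_ifs <;> omega
    · refine (ren_eq_self P _ fun j => ?_).symm
      have := j.isLt
      simp only [Function.comp, liftRen_val, mergeLast_val, Fin.val_castSucc, Fin.val_last]
      split_ifs <;> omega
  rw [h, hK.copy hv, inst_inst_weaken, ← ren_inst, hK.comm hv]

/-- Simultaneous instantiation of the last `n` variables in a shared context. -/
def multiInst {m : ℕ} : ∀ (n : ℕ), P.C (m + n) → (Fin n → P.C m) → P.C m
  | 0, x, _ => x
  | n + 1, x, σ =>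
      multiInst n (inst P (p := m + n) x (P.ren (σ (Fin.last n)) (Fin.castAdd n)))
        (fun i => σ i.castSucc)

/-- Simultaneous instantiation of all variables. -/
def simul {n m : ℕ} (x : P.C n) (σ : Fin n → P.C m) : P.C m :=
  multiInst P n (P.ren x (Fin.natAdd m)) σ

/-- The renaming moving the last variable in front of the last `n` of the others. -/
def rotLast (m n : ℕ) : Ren (m + n + 1) (m + 1 + n) :=
  fun i => ⟨if i.val < m then i.val else if i.val < m + n then i.val + 1 else m,
    by split_ifs <;> omega⟩

theorem rotLast_val {m n : ℕ} (i : Fin (m + n + 1)) :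
    (rotLast m n i).val =
      if i.val < m then i.val else if i.val < m + n then i.val + 1 else m := rfl

theorem ren_multiInst {m m' : ℕ} (r : Ren m m') : ∀ {n : ℕ} (x : P.C (m + n))
    (σ : Fin n → P.C m),
    P.ren (multiInst P n x σ) r =
      multiInst P n (P.ren x (bsum r (idRen n))) (fun i => P.ren (σ i) r)
  | 0, x, σ => ren_congr P x fun i => by
      have := i.isLt
      simp only [bsum_val]
      split_ifs <;> first | rfl | omega
  | n + 1, x, σ => by
      rw [multiInst, multiInst, ren_multiInst r, ren_inst]
      congr 2
      · refine ren_congr P _ fun i => ?_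
        have := i.isLt
        simp only [bsum_val, liftRen_val, idRen]
        split_ifs <;> omega
      · rw [← P.ren_comp, ← P.ren_comp]
        refine ren_congr P _ fun i => ?_
        simp [bsum]

theorem multiInst_castAdd {K : ∀ {n : ℕ}, P.C n → Prop} (hK : ValueClass P @K) {m : ℕ} :
    ∀ {n : ℕ} (x : P.C m) (σ : Fin n → P.C m) (_ : ∀ i, K (σ i)),
      multiInst P n (P.ren x (Fin.castAdd n)) σ = x
  | 0, x, _, _ => P.ren_id x
  | n + 1, x, σ, hσ => by
      have h : P.ren x (Fin.castAdd (n + 1)) =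
          P.ren (P.ren x (Fin.castAdd n)) (Fin.castSucc (n := m + n)) := by
        rw [← P.ren_comp]; rfl
      rw [multiInst, h, hK.discard (hK.ren _ (hσ _)), multiInst_castAdd hK _ _ fun i => hσ _]

theorem multiInst_var {m : ℕ} : ∀ {n : ℕ} (x : P.C (m + n)) (s : Fin n → Fin m),
    multiInst P n x (fun i => P.ren P.one (fun _ => s i)) =
      P.ren x (Fin.addCases (motive := fun _ => Fin m) (fun a => a) s)
  | 0, x, s => (ren_eq_self P x fun i => by
      refine Fin.addCases (fun a => ?_) (fun b => b.elim0) i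
      exact congrArg Fin.val (Fin.addCases_left (n := 0) a)).symm
  | n + 1, x, s => by
      have h : P.ren (P.ren P.one (fun _ => s (Fin.last n))) (Fin.castAdd n) =
          P.ren P.one (fun _ => Fin.castAdd n (s (Fin.last n))) := by
        rw [← P.ren_comp]; rfl
      rw [multiInst, h, inst_var P (p := m + n), multiInst_var _ (fun i => s i.castSucc),
        ← P.ren_comp]
      refine ren_congr P x fun i => ?_
      refine Fin.addCases (fun a => ?_) (fun b => ?_) i
      · have h : mergeLast (Fin.castAdd n (s (Fin.last n))) (Fin.castAdd (n + 1) a) =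
            Fin.castAdd n a := by
          refine Fin.ext ?_
          have := a.isLt
          simp (disch := omega) [mergeLast_val]; omega
        rw [Function.comp_apply, h, Fin.addCases_left, Fin.addCases_left]
      · refine Fin.lastCases ?_ (fun b => ?_) b
        · have h : mergeLast (Fin.castAdd n (s (Fin.last n))) (Fin.natAdd m (Fin.last n)) =
              Fin.castAdd n (s (Fin.last n)) := by
            refine Fin.ext ?_
            simp [mergeLast_val]
          rw [Function.comp_apply, h, Fin.addCases_left, Fin.addCases_right]
        · have h : mergeLast (Fin.castAdd n (s (Fin.last n))) (Fin.natAdd m b.castSucc) =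
              Fin.natAdd m b := by
            refine Fin.ext ?_
            simp [mergeLast_val]
          rw [Function.comp_apply, h, Fin.addCases_right, Fin.addCases_right]

theorem multiInst_inst {K : ∀ {n : ℕ}, P.C n → Prop} (hK : ValueClass P @K) {m : ℕ} :
    ∀ {n : ℕ} (x : P.C (m + n + 1)) (u : P.C (m + n)) (σ : Fin n → P.C m) (_ : ∀ i, K (σ i)),
      multiInst P n (inst P x u) σ =
        inst P (multiInst P n (P.ren x (rotLast m n)) (fun i => P.ren (σ i) Fin.castSucc))
          (multiInst P n u σ)
  | 0, x, u, σ, _ => by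
      rw [multiInst, multiInst, multiInst]
      refine congrArg (fun z => inst P z u) (ren_eq_self P x fun i => ?_).symm
      have := i.isLt
      simp only [rotLast_val]
      split_ifs <;> omega
  | n + 1, x, u, σ, hσ => by
      rw [multiInst, multiInst, multiInst,
        hK.inst_inst (p := m + n) x u (hK.ren _ (hσ _)),
        multiInst_inst hK _ _ _ fun i => hσ _]
      congr 2
      rw [ren_inst P]
      congr 1
      · rw [← P.ren_comp]
        refine ren_congr P x fun i => ?_
        have := i.isLt
        rcases (by omega : i.val < m ∨ (m ≤ i.val ∧ i.val < m + n) ∨ i.val = m + n ∨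
          i.val = m + n + 1) with hi | hi | hi | hi <;>
        simp (disch := omega) only [Function.comp, liftRen_val, rotLast_val, swapLast_val,
          nat_lt_true, nat_lt_false, nat_eq_true, nat_eq_false, dite_true, dite_false, if_true,
          if_false]
      · rw [← P.ren_comp, ← P.ren_comp, ← P.ren_comp]
        refine ren_congr P _ fun i => ?_
        have := i.isLt
        simp (disch := omega) only [Function.comp, rotLast_val, Fin.val_castAdd,
          Fin.val_castSucc, nat_lt_true, if_true]

/-- The renaming moving the first `n` variables behind the others, inserting `m` fresh ones
in front. -/
def blockLast (n m t : ℕ) : Ren (n + t) (m + t + n) :=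
  fun i => Fin.addCases (motive := fun _ => Fin (m + t + n))
    (fun a => Fin.natAdd (m + t) a) (fun b => Fin.castAdd n (Fin.natAdd m b)) i

theorem blockLast_val {n m t : ℕ} (i : Fin (n + t)) :
    (blockLast n m t i).val = if i.val < n then m + t + i.val else m + (i.val - n) := by
  refine Fin.addCases (fun a => ?_) (fun b => ?_) i
  · simp [blockLast]
  · simp [blockLast]

/-- Simultaneous instantiation of the first `n` variables, keeping the last `t`. -/
def part {n m : ℕ} (t : ℕ) (x : P.C (n + t)) (τ : Fin n → P.C m) : P.C (m + t) :=
  multiInst P n (P.ren x (blockLast n m t)) (fun i => P.ren (τ i) (Fin.castAdd t))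

theorem part_zero {n m : ℕ} (x : P.C n) (τ : Fin n → P.C m) :
    part P 0 x τ = simul P x τ := by
  have h : (fun i => P.ren (τ i) (Fin.castAdd 0)) = τ := funext fun i => P.ren_id _
  rw [part, simul]
  refine (congrArg (multiInst P n _) h).trans ?_
  refine congrArg (fun z => multiInst P n z τ) (ren_congr P x fun i => ?_)
  have := i.isLt
  simp only [blockLast_val, Fin.val_natAdd]
  split_ifs <;> omega

theorem part_inst {K : ∀ {n : ℕ}, P.C n → Prop} (hK : ValueClass P @K) {n m t : ℕ}
    (x : P.C (n + t + 1)) (u : P.C (n + t)) (τ : Fin n → P.C m) (hτ : ∀ i, K (τ i)) :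
    part P t (inst P x u) τ = inst P (part P (t + 1) x τ) (part P t u τ) := by
  rw [part, ren_inst, multiInst_inst P hK _ _ _ fun i => hK.ren _ (hτ i), part, part]
  congr 2
  · rw [← P.ren_comp]
    refine ren_congr P x fun i => ?_
    have := i.isLt
    rcases (by omega : i.val < n ∨ (n ≤ i.val ∧ i.val < n + t) ∨ i.val = n + t)
      with hi | hi | hi <;>
    simp (disch := omega) only [Function.comp, liftRen_val, rotLast_val, blockLast_val,
      nat_lt_true, nat_lt_false, dite_true, dite_false, if_true, if_false] <;> omega
  · funext i
    rw [← P.ren_comp]; rfl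

theorem part_castAdd {n m t : ℕ} (x : P.C n) (τ : Fin n → P.C m) :
    part P t (P.ren x (Fin.castAdd t)) τ = P.ren (simul P x τ) (Fin.castAdd t) := by
  rw [part, simul, ren_multiInst, ← P.ren_comp, ← P.ren_comp]
  congr 1
  refine ren_congr P x fun i => ?_
  simp [blockLast, bsum, idRen]

theorem part_natAdd {K : ∀ {n : ℕ}, P.C n → Prop} (hK : ValueClass P @K) {n m t : ℕ}
    (x : P.C t) (τ : Fin n → P.C m) (hτ : ∀ i, K (τ i)) :
    part P t (P.ren x (Fin.natAdd n)) τ = P.ren x (Fin.natAdd m) := by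
  have h : P.ren (P.ren x (Fin.natAdd n)) (blockLast n m t) =
      P.ren (P.ren x (Fin.natAdd m)) (Fin.castAdd n) := by
    rw [← P.ren_comp, ← P.ren_comp]
    refine ren_congr P x fun i => ?_
    simp [blockLast]
  rw [part, h, multiInst_castAdd P hK _ _ fun i => hK.ren _ (hτ i)]

theorem simul_multiInst {K : ∀ {n : ℕ}, P.C n → Prop} (hK : ValueClass P @K) {k m : ℕ}
    (τ : Fin k → P.C m) (hτ : ∀ i, K (τ i)) : ∀ {n : ℕ} (x : P.C (k + n)) (σ : Fin n → P.C k),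
    simul P (multiInst P n x σ) τ = multiInst P n (part P n x τ) (fun i => simul P (σ i) τ)
  | 0, x, _ => (part_zero P x τ).symm
  | n + 1, x, σ => by
      rw [multiInst, simul_multiInst hK τ hτ, part_inst P hK _ _ _ hτ, part_castAdd, multiInst]

theorem simul_simul {K : ∀ {n : ℕ}, P.C n → Prop} (hK : ValueClass P @K) {n k m : ℕ}
    (x : P.C n) (σ : Fin n → P.C k) (τ : Fin k → P.C m) (hτ : ∀ i, K (τ i)) :
    simul P (simul P x σ) τ = simul P x (fun i => simul P (σ i) τ) := by
  rw [show simul P x σ = multiInst P n _ σ from rfl, simul_multiInst P hK τ hτ,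
    part_natAdd P hK _ _ hτ, simul]

theorem ren_simul {n m m' : ℕ} (x : P.C n) (σ : Fin n → P.C m) (r : Ren m m') :
    P.ren (simul P x σ) r = simul P x (fun i => P.ren (σ i) r) := by
  rw [simul, ren_multiInst, simul, ← P.ren_comp]
  congr 1
  refine ren_congr P x fun i => ?_
  simp [bsum, idRen]

/-- Lift a simultaneous instantiation under a binder. -/
def liftInst {n m : ℕ} (τ : Fin n → P.C m) : Fin (n + 1) → P.C (m + 1) :=
  fun i => Fin.lastCases (motive := fun _ => P.C (m + 1)) (P.ren P.one (fun _ => Fin.last m))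
    (fun j => P.ren (τ j) Fin.castSucc) i

theorem simul_liftInst {n m : ℕ} (x : P.C (n + 1)) (τ : Fin n → P.C m) :
    simul P x (liftInst P τ) = part P 1 x τ := by
  have h : P.ren (P.ren P.one (fun _ => Fin.last m)) (Fin.castAdd n) =
      P.ren P.one (fun _ => Fin.castAdd n (Fin.last m)) := by
    rw [← P.ren_comp]; rfl
  rw [simul, multiInst, part]
  simp only [liftInst, Fin.lastCases_last, Fin.lastCases_castSucc]
  rw [h, inst_var P (p := m + 1 + n), ← P.ren_comp]
  refine congrArg (fun z => multiInst P n z _) (ren_congr P x fun i => ?_)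
  have := i.isLt
  simp only [Function.comp, mergeLast_val, blockLast_val, Fin.val_natAdd, Fin.val_castAdd,
    Fin.val_last]
  split_ifs <;> omega

theorem simul_inst {K : ∀ {n : ℕ}, P.C n → Prop} (hK : ValueClass P @K) {n m : ℕ}
    (x : P.C (n + 1)) (u : P.C n) (τ : Fin n → P.C m) (hτ : ∀ i, K (τ i)) :
    simul P (inst P x u) τ = inst P (simul P x (liftInst P τ)) (simul P u τ) := by
  rw [simul_liftInst, ← part_zero, part_inst P hK (t := 0) _ _ _ hτ, part_zero]

theorem simul_var {n m : ℕ} (x : P.C n) (s : Ren n m) :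
    simul P x (fun i => P.ren P.one (fun _ => s i)) = P.ren x s := by
  rw [simul, multiInst_var, ← P.ren_comp]
  refine ren_congr P x fun i => ?_
  simp

theorem one_simul {K : ∀ {n : ℕ}, P.C n → Prop} (hK : ValueClass P @K) {m : ℕ} :
    ∀ {n : ℕ} (i : Fin n) (τ : Fin n → P.C m) (_ : ∀ i, K (τ i)),
      simul P (P.ren P.one (fun _ => i)) τ = τ i
  | n + 1, i, τ, hτ => by
      rw [simul, multiInst, ← P.ren_comp]
      refine Fin.lastCases ?_ (fun j => ?_) i
      · rw [show (Fin.natAdd m ∘ fun _ : Fin 1 => Fin.last n) = fun _ => Fin.last (m + n) from rfl,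
          inst_one_last P (p := m + n), multiInst_castAdd P hK _ _ fun i => hτ _]
      · have h : P.ren P.one (Fin.natAdd m ∘ fun _ : Fin 1 => j.castSucc) =
            P.ren (P.ren (P.ren P.one (fun _ : Fin 1 => j)) (Fin.natAdd m))
              (Fin.castSucc (n := m + n)) := by
          rw [← P.ren_comp, ← P.ren_comp]; rfl
        rw [h, hK.discard (hK.ren _ (hτ _))]
        exact one_simul hK j (fun i => τ i.castSucc) fun i => hτ _

/-- Juxtaposition of a family of elements with one more element, in disjoint contexts. -/
def juxt {n m k : ℕ} (τ : Fin n → P.C m) (v : P.C k) : Fin (n + 1) → P.C (m + k) :=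
  fun i => Fin.lastCases (motive := fun _ => P.C (m + k)) (P.ren v (Fin.natAdd m))
    (fun j => P.ren (τ j) (Fin.castAdd k)) i

theorem part_juxt {n m k t : ℕ} (x : P.C (n + 1 + t)) (τ : Fin n → P.C m) (v : P.C k) :
    part P t x (juxt P τ v) =
      P.ren (part P (k + t)
        (P.ren (P.subst n t x v) (Fin.cast (by omega : n + k + t = n + (k + t)))) τ)
        (Fin.cast (by omega)) := by
  rw [part, part, multiInst, ren_multiInst, subst_eq_inst]
  simp only [juxt, Fin.lastCases_last, Fin.lastCases_castSucc]
  simp only [ren_inst, ← P.ren_comp]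
  refine congrArg₂ (fun z s => multiInst P n z s) (congrArg₂ (fun z s => inst P z s) ?_ ?_) ?_
  · refine ren_congr P x fun i => ?_
    have := i.isLt
    rcases (by omega : i.val < n ∨ i.val = n ∨ n < i.val) with hi | hi | hi <;>
    simp (disch := omega) only [Function.comp, liftRen_val, blockLast_val, midToLast_val,
      bsum_val, idRen, Fin.val_cast, nat_lt_true, nat_lt_false, nat_eq_true, nat_eq_false,
      dite_true, dite_false, if_true, if_false]
  · refine ren_congr P v fun i => ?_
    have := i.isLt
    simp (disch := omega) only [Function.comp, blockLast_val, embM_val,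
      bsum_val, idRen, Fin.val_cast, Fin.val_castAdd, Fin.val_natAdd, nat_lt_true, nat_lt_false,
      nat_eq_true, dite_true, if_false]
  · funext i
    exact ren_congr P _ fun j => rfl

theorem blockInj_last {n : ℕ} (k : Fin (n + 1) → ℕ) :
    blockInj k (Fin.last n) = Fin.natAdd (finSum fun j => k j.castSucc) :=
  Fin.lastCases_last (motive := fun i => Fin (k i) → Fin (finSum k))

theorem blockInj_castSucc {n : ℕ} (k : Fin (n + 1) → ℕ) (j : Fin n) :
    blockInj k j.castSucc = Fin.castAdd (k (Fin.last n)) ∘ blockInj (fun i => k i.castSucc) j :=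
  Fin.lastCases_castSucc (motive := fun i => Fin (k i) → Fin (finSum k)) j

theorem blocks_succ {n : ℕ} (k : Fin (n + 1) → ℕ) (g : ∀ i, P.C (k i)) :
    (fun i => P.ren (g i) (blockInj k i)) =
      juxt P (fun i => P.ren (g i.castSucc) (blockInj (fun i => k i.castSucc) i))
        (g (Fin.last n)) := by
  funext i
  refine Fin.lastCases ?_ (fun j => ?_) i
  · rw [juxt, Fin.lastCases_last, blockInj_last]
    rfl
  · rw [juxt, Fin.lastCases_castSucc, blockInj_castSucc]
    exact P.ren_comp _ _ _

theorem psubAux_eq_part : ∀ {n : ℕ} (k : Fin n → ℕ) (t : ℕ) (f : P.C (n + t))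
    (g : ∀ i, P.C (k i)),
    P.toPreoperad.psubAux k t f g = part P t f (fun i => P.ren (g i) (blockInj k i))
  | 0, k, t, f, g => (ren_eq_self P (m := 0 + t) f fun i => by
      have : i.val < 0 + t := i.isLt
      simp only [blockLast_val, finSum]
      split_ifs <;> omega).symm
  | n + 1, k, t, f, g => by
      rw [blocks_succ]
      refine Eq.trans ?_ (part_juxt P f _ _).symm
      rw [Preoperad.psubAux, psubAux_eq_part, acast_eq_ren, acast_eq_ren]
      rfl

theorem psub_eq_simul {n : ℕ} (k : Fin n → ℕ) (f : P.C n) (g : ∀ i, P.C (k i)) :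
    P.toPreoperad.psub k f g = simul P f (fun i => P.ren (g i) (blockInj k i)) :=
  (psubAux_eq_part P k 0 f g).trans (part_zero P _ _)

theorem finSumCases_blockInj {α : Type} : ∀ {n : ℕ} (k : Fin n → ℕ) (h : ∀ i, Fin (k i) → α)
    (i : Fin n) (a : Fin (k i)), finSumCases k h (blockInj k i a) = h i a
  | n + 1, k, h, i => by
      refine Fin.lastCases ?_ (fun j => ?_) i
      · intro a
        rw [blockInj_last]
        exact Fin.addCases_right a
      · intro a
        rw [blockInj_castSucc, ← finSumCases_blockInj (fun i => k i.castSucc)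
          (fun i => h i.castSucc) j a]
        exact Fin.addCases_left _

theorem ren_psub_const {n m : ℕ} (f : P.C n) (g : Fin n → P.C m) :
    P.ren (P.toPreoperad.psub (fun _ => m) f g) (finSumCases (fun _ => m) (fun _ a => a)) =
      simul P f g := by
  rw [psub_eq_simul, ren_simul]
  congr 1
  funext i
  rw [← P.ren_comp]
  refine ren_eq_self P _ fun j => ?_
  exact congrArg Fin.val (finSumCases_blockInj (fun _ => m) (fun _ a => a) i j)

theorem blockInj_strictMono : ∀ {n : ℕ} (k : Fin n → ℕ) (i : Fin n), StrictMono (blockInj k i)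
  | n + 1, k, i => by
      refine Fin.lastCases ?_ (fun j => ?_) i
      · rw [blockInj_last]
        exact fun a b h => Nat.add_lt_add_left h _
      · rw [blockInj_castSucc]
        exact fun a b h => blockInj_strictMono (fun i => k i.castSucc) j h

end Simultaneous

section Abstraction

variable (F : WCFreydOperad)

theorem map_multiInst {m : ℕ} : ∀ {n : ℕ} (x : F.V.C (m + n)) (σ : Fin n → F.V.C m),
    F.I.map (multiInst F.V.toSymRenPreoperad n x σ) =
      multiInst F.C n (F.I.map x) (fun i => F.I.map (σ i))
  | 0, _, _ => rfl
  | n + 1, x, σ => by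
      rw [multiInst, map_multiInst, map_inst F (p := m + n), F.I.map_ren]
      rfl

theorem map_simul {n m : ℕ} (x : F.V.C n) (σ : Fin n → F.V.C m) :
    F.I.map (simul F.V.toSymRenPreoperad x σ) =
      simul F.C (F.I.map x) (fun i => F.I.map (σ i)) := by
  rw [simul, map_multiInst, F.I.map_ren]
  rfl

theorem abs_ren_cast {m n : ℕ} (h : m = n) (f : F.C.C (m + 1)) :
    F.abs (F.C.ren f (Fin.cast (congrArg (· + 1) h))) = F.V.ren (F.abs f) (Fin.cast h) := by
  subst h
  exact (congrArg F.abs (F.C.ren_id f)).trans (F.V.ren_id _).symm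

theorem abs_subst_map {n t k : ℕ} (f : F.C.C (n + 1 + t + 1)) (v : F.V.C k) :
    F.abs (n := n + k + t) (F.C.subst n (t + 1) f (F.I.map v)) =
      F.V.subst n t (F.abs f) v :=
  F.abs_subst (m₁ := n) (m₂ := t) f v

/-- Abstraction is compatible with inserting fresh variables in front. -/
theorem abs_ren_natAdd {m t : ℕ} (f : F.C.C (t + 1)) :
    F.abs (n := m + t) (F.C.ren f (Fin.natAdd m)) = F.V.ren (F.abs f) (Fin.natAdd m) := by
  let w : F.V.C 0 := F.abs (n := 0) F.C.one
  let g : F.C.C (0 + 1 + t + 1) := F.C.ren f (Fin.cast (by omega) ∘ Fin.natAdd 1)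
  have key (k : ℕ) (v : F.V.C k) : F.abs (F.C.ren f (Fin.cast (by omega) ∘ Fin.natAdd k)) =
      F.V.subst 0 t (F.abs g) v := by
    rw [← abs_subst_map, subst_eq_inst F.C, ← F.I.map_ren]
    have h : F.C.ren g (midToLast 0 (t + 1) k) = F.C.ren (F.C.ren f
        (Fin.cast (by omega : k + (t + 1) = 0 + k + (t + 1)) ∘ Fin.natAdd k)) Fin.castSucc := by
      simp only [g]
      rw [← F.C.ren_comp, ← F.C.ren_comp]
      refine ren_congr F.C f fun i => ?_
      have := i.isLt
      simp (disch := omega) only [Function.comp, midToLast_val, Fin.val_cast, Fin.val_natAdd,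
        Fin.val_castSucc, nat_lt_false, nat_eq_false, if_false]
      omega
    rw [h, inst_discard_map]
  have h₀ := key 0 w
  have h₁ := key m (F.V.ren w (discardRen m))
  have e : F.V.subst 0 t (F.abs g) (F.V.ren w (discardRen m)) =
      F.V.ren (F.V.subst 0 t (F.abs g) w)
        (Fin.cast (by omega) ∘ Fin.natAdd m ∘ Fin.cast (by omega : 0 + 0 + t = t)) := by
    rw [subst_eq_inst F.V.toSymRenPreoperad, subst_eq_inst F.V.toSymRenPreoperad, ren_inst,
      ← F.V.ren_comp, ← F.V.ren_comp, ← F.V.ren_comp]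
    congr 1
    · refine ren_congr F.V.toSymRenPreoperad _ fun i => ?_
      have := i.isLt
      rcases (by omega : i.val = 0 ∨ 0 < i.val) with hi | hi <;>
      simp (disch := omega) only [Function.comp, midToLast_val, liftRen_val, Fin.val_cast,
        Fin.val_natAdd, nat_lt_true, nat_lt_false, nat_eq_true, nat_eq_false, dite_true,
        dite_false, if_true, if_false]
    · exact ren_congr F.V.toSymRenPreoperad _ fun i => i.elim0
  rw [e, ← h₀] at h₁
  have h₂ := abs_ren_cast F (by omega : t = 0 + 0 + t) f
  have h₃ := abs_ren_cast F (by omega : m + t = 0 + m + t) (F.C.ren f (Fin.natAdd m))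
  rw [← F.C.ren_comp] at h₃
  have h₄ : F.C.ren f (Fin.cast (by omega : 0 + (t + 1) = 0 + 0 + t + 1) ∘ Fin.natAdd 0) =
      F.C.ren f (Fin.cast (congrArg (· + 1) (by omega : t = 0 + 0 + t))) :=
    ren_congr F.C f fun i => by simp
  have h₅ := h₁.symm.trans h₃
  rw [h₄, h₂] at h₅
  have h₆ := congrArg (fun z => F.V.ren z (Fin.cast (by omega : 0 + m + t = m + t))) h₅
  simp only [← F.V.ren_comp] at h₆
  refine Eq.trans ?_ (h₆.symm.trans ?_)
  · exact (ren_eq_self F.V.toSymRenPreoperad _ fun i => rfl).symm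
  · exact ren_congr F.V.toSymRenPreoperad _ fun i => rfl

/-- Families of values in consecutive disjoint contexts. -/
inductive Separated : ∀ {n m : ℕ}, (Fin n → F.V.C m) → Prop
  | nil {m : ℕ} (τ : Fin 0 → F.V.C m) : Separated τ
  | juxt {n m k : ℕ} {τ : Fin n → F.V.C m} (v : F.V.C k) (h : Separated τ) :
      Separated (juxt F.V.toSymRenPreoperad τ v)

theorem abs_part {n m : ℕ} {τ : Fin n → F.V.C m} (h : Separated F τ) :
    ∀ {t : ℕ} (f : F.C.C (n + t + 1)),
      F.abs (n := m + t) (part F.C (t + 1) f (fun i => F.I.map (τ i))) =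
        part F.V.toSymRenPreoperad t (F.abs f) τ := by
  induction h with
  | @nil m τ =>
    intro t f
    have h := abs_ren_cast F (by omega : 0 + t = t) f
    have h' := abs_ren_natAdd F (m := m) (F.C.ren f (Fin.cast (congrArg (· + 1) (by omega : 0 + t = t))))
    rw [h] at h'
    refine Eq.trans ?_ (h'.trans ?_)
    · refine congrArg (F.abs (n := m + t)) ?_
      rw [← F.C.ren_comp]
      refine ren_congr F.C f fun i => ?_
      simp [blockLast_val, Function.comp]
    · rw [← F.V.ren_comp]
      refine ren_congr F.V.toSymRenPreoperad _ fun i => ?_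
      simp [blockLast_val, Function.comp]
  | @juxt n m k τ v h ih =>
    intro t f
    rw [part_juxt]
    have e : (fun i => F.I.map (juxt F.V.toSymRenPreoperad τ v i)) =
        juxt F.C (fun i => F.I.map (τ i)) (F.I.map v) := by
      funext i
      refine Fin.lastCases ?_ (fun j => ?_) i <;> simp [juxt, F.I.map_ren]
    rw [e, part_juxt, ← abs_subst_map, ← abs_ren_cast F (by omega), ← ih, ← abs_ren_cast F]
    rfl

theorem Separated.blocks : ∀ {n : ℕ} (k : Fin n → ℕ) (g : ∀ i, F.V.C (k i)),
    Separated F (fun i => F.V.ren (g i) (blockInj k i))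
  | 0, _, _ => .nil _
  | n + 1, k, g => by
      rw [blocks_succ F.V.toSymRenPreoperad]
      exact .juxt _ (Separated.blocks _ _)

theorem Separated.liftInst {n m : ℕ} {τ : Fin n → F.V.C m} (h : Separated F τ) :
    Separated F (liftInst F.V.toSymRenPreoperad τ) := by
  have e : _root_.liftInst F.V.toSymRenPreoperad τ =
      _root_.juxt F.V.toSymRenPreoperad τ F.V.one := by
    funext i
    refine Fin.lastCases ?_ (fun j => ?_) i
    · simp only [_root_.liftInst, _root_.juxt, Fin.lastCases_last]
      exact ren_congr F.V.toSymRenPreoperad _ fun i => by simp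
    · simp only [_root_.liftInst, _root_.juxt, Fin.lastCases_castSucc]
      rfl
  rw [e]
  exact .juxt _ h

theorem Separated.vars : ∀ {n m : ℕ} (r : Fin n → Fin m) (_ : StrictMono r),
    Separated F (fun i => F.V.ren F.V.one (fun _ => r i))
  | 0, _, _, _ => .nil _
  | n + 1, m, r, hr => by
      obtain ⟨p, k, hm, hp⟩ : ∃ p k, m = p + (k + 1) ∧ (r (Fin.last n)).val = p :=
        ⟨(r (Fin.last n)).val, m - (r (Fin.last n)).val - 1, by omega, rfl⟩
      subst hm
      have hlt (j : Fin n) : (r j.castSucc).val < p :=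
        lt_of_lt_of_eq (hr (Fin.castSucc_lt_last j)) hp
      have h : (fun i => F.V.ren F.V.one (fun _ => r i)) =
          _root_.juxt F.V.toSymRenPreoperad (k := k + 1)
            (fun i => F.V.ren F.V.one (fun _ => (⟨(r i.castSucc).val, hlt i⟩ : Fin p)))
            (F.V.ren F.V.one (fun _ => 0)) := by
        funext i
        refine Fin.lastCases ?_ (fun j => ?_) i
        · simp only [_root_.juxt, Fin.lastCases_last, ← F.V.ren_comp]
          exact ren_congr F.V.toSymRenPreoperad _ fun i => by simp [hp]
        · simp only [_root_.juxt, Fin.lastCases_castSucc, ← F.V.ren_comp]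
          exact ren_congr F.V.toSymRenPreoperad _ fun i => by simp
      rw [h]
      exact .juxt _ (Separated.vars _ fun i j hij => hr (Fin.castSucc_lt_castSucc_iff.2 hij))

theorem abs_simul {n m : ℕ} {τ : Fin n → F.V.C m} (h : Separated F τ) (f : F.C.C (n + 1)) :
    F.abs (simul F.C f (liftInst F.C (fun i => F.I.map (τ i)))) =
      simul F.V.toSymRenPreoperad (F.abs f) τ := by
  rw [simul_liftInst, ← part_zero]
  exact abs_part F h (t := 0) f

theorem abs_ren {n m : ℕ} (r : Fin n → Fin m) (hr : StrictMono r) (f : F.C.C (n + 1)) :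
    F.abs (F.C.ren f (liftRen r)) = F.V.ren (F.abs f) r := by
  have h := abs_simul F (Separated.vars F r hr) f
  rw [simul_var] at h
  rw [← h, ← simul_var F.C]
  congr 2
  funext i
  refine Fin.lastCases ?_ (fun j => ?_) i
  · simp only [liftInst, liftRen_last, Fin.lastCases_last]
  · simp only [liftInst, liftRen_castSucc, Fin.lastCases_castSucc, F.I.map_ren, F.I.map_one,
      ← F.C.ren_comp]
    rfl

end Abstraction

section Interpretation

variable {Sg : Sig} (S : CLCStructure Sg)

theorem interpV_func {n : ℕ} (f : Sg.Func) (args : Fin (Sg.fArity f) → DVal Sg n) :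
    interpV S (.func f args) =
      simul S.O.V.toSymRenPreoperad (S.Ff f) (fun i => interpV S (args i)) := by
  rw [interpV]
  exact ren_psub_const S.O.V.toSymRenPreoperad _ _

theorem interpC_letin {n : ℕ} (M₁ : DCmp Sg n) (M₂ : DCmp Sg (n + 1)) :
    interpC S (.letin M₁ M₂) = inst S.O.C (interpC S M₂) (interpC S M₁) := by
  rw [interpC]
  rfl

theorem interpC_proc {n : ℕ} (p : Sg.Proc) (args : Fin (Sg.pArity p) → DVal Sg n) :
    interpC S (.proc p args) =
      simul S.O.C (S.Pp p) (fun i => S.O.I.map (interpV S (args i))) := by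
  rw [interpC]
  exact ren_psub_const S.O.C _ _

theorem interpC_app {n : ℕ} (W₁ W₂ : DVal Sg n) :
    interpC S (.app W₁ W₂) =
      simul S.O.C S.O.app (fun i : Fin 2 =>
        S.O.I.map (Fin.cases (motive := fun _ => S.O.V.C n) (interpV S W₁)
          (fun _ => interpV S W₂) i)) := by
  rw [interpC]
  exact ren_psub_const S.O.C _ _

theorem liftRen_strictMono {m n : ℕ} {r : Fin m → Fin n} (hr : StrictMono r) :
    StrictMono (liftRen r) := by
  intro i j h
  rw [Fin.lt_def, liftRen_val, liftRen_val]
  have := j.isLt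
  rw [Fin.lt_def] at h
  split_ifs with h₁ h₂
  · exact hr h
  · exact (r _).isLt
  · omega
  · omega

mutual
theorem interpV_renameV : ∀ {m n : ℕ} (W : DVal Sg m) (r : Fin m → Fin n) (_ : StrictMono r),
    interpV S (renameV W r) = S.O.V.ren (interpV S W) r
  | _, _, .var i, r, _ => by
      rw [renameV, interpV, interpV, ← S.O.V.ren_comp]
      rfl
  | _, _, .func f args, r, hr => by
      rw [renameV, interpV_func, interpV_func, ren_simul S.O.V.toSymRenPreoperad]
      congr 1
      funext i
      exact interpV_renameV (args i) r hr
  | _, _, .lam M, r, hr => by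
      rw [renameV, interpV, interpV, interpC_renameC M _ (liftRen_strictMono hr), abs_ren _ _ hr]

theorem interpC_renameC : ∀ {m n : ℕ} (M : DCmp Sg m) (r : Fin m → Fin n) (_ : StrictMono r),
    interpC S (renameC M r) = S.O.C.ren (interpC S M) r
  | _, _, .ret W, r, hr => by
      rw [renameC, interpC, interpC, interpV_renameV W r hr, S.O.I.map_ren]
  | _, _, .letin M₁ M₂, r, hr => by
      rw [renameC, interpC_letin, interpC_letin, ren_inst, interpC_renameC M₁ r hr,
        interpC_renameC M₂ _ (liftRen_strictMono hr)]
  | _, _, .proc p args, r, hr => by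
      rw [renameC, interpC_proc, interpC_proc, ren_simul]
      congr 1
      funext i
      rw [interpV_renameV (args i) r hr, S.O.I.map_ren]
  | _, _, .app W₁ W₂, r, hr => by
      rw [renameC, interpC_app, interpC_app, ren_simul]
      congr 1
      funext i
      rw [← S.O.I.map_ren, interpV_renameV W₁ r hr, interpV_renameV W₂ r hr]
      refine Fin.cases ?_ (fun _ => ?_) i <;> rfl
end

theorem interpV_liftSub {m n : ℕ} (σ : Fin m → DVal Sg n) :
    (fun i => interpV S (liftSub σ i)) =
      liftInst S.O.V.toSymRenPreoperad (fun i => interpV S (σ i)) := by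
  funext i
  refine Fin.lastCases ?_ (fun j => ?_) i
  · simp only [liftSub, liftInst, Fin.lastCases_last]
    rw [interpV]
  · simp only [liftSub, liftInst, Fin.lastCases_castSucc]
    exact interpV_renameV S (σ j) _ Fin.strictMono_castSucc

theorem map_interpV_liftSub {m n : ℕ} (σ : Fin m → DVal Sg n) :
    (fun i => S.O.I.map (interpV S (liftSub σ i))) =
      liftInst S.O.C (fun i => S.O.I.map (interpV S (σ i))) := by
  funext i
  rw [congrFun (interpV_liftSub S σ) i]
  refine Fin.lastCases ?_ (fun j => ?_) i
  · simp only [liftInst, Fin.lastCases_last]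
    rw [S.O.I.map_ren, S.O.I.map_one]
  · simp only [liftInst, Fin.lastCases_castSucc]
    rw [S.O.I.map_ren]

mutual
theorem interpV_substV : ∀ {m n : ℕ} (W : DVal Sg m) (σ : Fin m → DVal Sg n)
    (_ : Separated S.O (fun i => interpV S (σ i))),
    interpV S (substV W σ) =
      simul S.O.V.toSymRenPreoperad (interpV S W) (fun i => interpV S (σ i))
  | _, _, .var i, σ, _ => by
      rw [substV, interpV]
      exact (one_simul _ S.O.V.valueClass i (fun i => interpV S (σ i)) fun _ => trivial).symm
  | _, _, .func f args, σ, hσ => by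
      rw [substV, interpV_func, interpV_func,
        simul_simul _ S.O.V.valueClass _ _ _ fun _ => trivial]
      congr 1
      funext i
      exact interpV_substV (args i) σ hσ
  | _, _, .lam M, σ, hσ => by
      have h := interpC_substC M (liftSub σ) (by rw [interpV_liftSub]; exact hσ.liftInst)
      rw [substV, interpV, interpV, h, map_interpV_liftSub, abs_simul _ hσ]

theorem interpC_substC : ∀ {m n : ℕ} (M : DCmp Sg m) (σ : Fin m → DVal Sg n)
    (_ : Separated S.O (fun i => interpV S (σ i))),
    interpC S (substC M σ) =
      simul S.O.C (interpC S M) (fun i => S.O.I.map (interpV S (σ i)))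
  | _, _, .ret W, σ, hσ => by
      rw [substC, interpC, interpC, interpV_substV W σ hσ, map_simul]
  | _, _, .letin M₁ M₂, σ, hσ => by
      have h := interpC_substC M₂ (liftSub σ) (by rw [interpV_liftSub]; exact hσ.liftInst)
      rw [substC, interpC_letin, interpC_letin,
        simul_inst _ S.O.valueClass _ _ _ fun _ => ⟨_, rfl⟩, h, map_interpV_liftSub,
        interpC_substC M₁ σ hσ]
  | _, _, .proc p args, σ, hσ => by
      rw [substC, interpC_proc, interpC_proc,
        simul_simul _ S.O.valueClass _ _ _ fun _ => ⟨_, rfl⟩]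
      congr 1
      funext i
      rw [interpV_substV (args i) σ hσ, map_simul]
  | _, _, .app W₁ W₂, σ, hσ => by
      rw [substC, interpC_app, interpC_app,
        simul_simul _ S.O.valueClass _ _ _ fun _ => ⟨_, rfl⟩]
      congr 1
      funext i
      rw [← map_simul, interpV_substV W₁ σ hσ, interpV_substV W₂ σ hσ]
      refine Fin.cases ?_ (fun _ => ?_) i <;> rfl
end

end Interpretation

/-- **fundamental lemma.** Let `S` be a λ_CLC-structure with underlying
weakly closed Freyd operad `(V, C, I)`.  For contexts `Γ₁, …, Γₙ` (of sizes `k i`) and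
values `Γᵢ ⊢ᵥ Vᵢ`: every value `x₁, …, xₙ ⊢ᵥ W` satisfies
`⟦W[x₁ := V₁, …, xₙ := Vₙ]⟧ = ⟦W⟧{⟦V₁⟧ + … + ⟦Vₙ⟧}`, and every computation
`x₁, …, xₙ ⊢꜀ M` satisfies `⟦M[x₁ := V₁, …, xₙ := Vₙ]⟧ = ⟦M⟧{I⟦V₁⟧ + … + I⟦Vₙ⟧}`,
where the braces denote the parallel substitution of the given central elements into the
`n` inputs. -/
theorem stmt15 {Sg : Sig} (S : CLCStructure Sg) {n : ℕ} (k : Fin n → ℕ)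
    (Vs : ∀ i, DVal Sg (k i)) :
    (∀ W : DVal Sg n,
      interpV S (substV W (fun i => renameV (Vs i) (blockInj k i))) =
        S.O.V.toPreoperad.psub k (interpV S W) (fun i => interpV S (Vs i))) ∧
    (∀ M : DCmp Sg n,
      interpC S (substC M (fun i => renameV (Vs i) (blockInj k i))) =
        S.O.C.toPreoperad.psub k (interpC S M) (fun i => S.O.I.map (interpV S (Vs i)))) := by
  have e (i : Fin n) : interpV S (renameV (Vs i) (blockInj k i)) =
      S.O.V.ren (interpV S (Vs i)) (blockInj k i) :=
    interpV_renameV S (Vs i) _ (blockInj_strictMono k i)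
  have h : Separated S.O (fun i => interpV S (renameV (Vs i) (blockInj k i))) := by
    simp only [e]
    exact Separated.blocks S.O k _
  refine ⟨fun W => ?_, fun M => ?_⟩
  · rw [interpV_substV S W _ h, psub_eq_simul S.O.V.toSymRenPreoperad]
    simp only [e]
  · rw [interpC_substC S M _ h, psub_eq_simul S.O.C]
    simp only [e, S.O.I.map_ren]
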